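/- Let (X_n) be the stationary Markov chain of an admissible iterated function system with initial distribution its unique invariant measure μ* on (0,1), and let φ be Lipschitz on [0,1] with ∫ φ dμ* = 0. Then σ² := lim_{n→∞} E[((φ(X₀)+⋯+φ(X_n))/√n)²] exists and (φ(X₀)+⋯+φ(X_n))/√n converges in distribution to the normal law N(0, σ²). -/

import Mathlib

open Set MeasureTheory Finset Filter

/-- An admissible iterated function system on `[0,1]`: increasing homeomorphisms of
`[0,1]` fixing the endpoints, `C¹` near the endpoints with positive derivatives
`d i` at `0` and `e i` at `1`, positive probabilities, positive Lyapunov exponents at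
both endpoints, and at every interior point some map moves it left and some right. -/
structure AdmissibleIFS (N : ℕ) (f : Fin N → ℝ → ℝ) (p d e : Fin N → ℝ) : Prop where
  meas : ∀ i, Measurable (f i)
  mono : ∀ i, StrictMonoOn (f i) (Icc 0 1)
  maps : ∀ i, MapsTo (f i) (Icc 0 1) (Icc 0 1)
  cont : ∀ i, ContinuousOn (f i) (Icc 0 1)
  surj : ∀ i, SurjOn (f i) (Icc 0 1) (Icc 0 1)
  fix0 : ∀ i, f i 0 = 0
  fix1 : ∀ i, f i 1 = 1
  ppos : ∀ i, 0 < p i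
  psum : ∑ i, p i = 1
  c1 : ∀ i, ∃ η > (0:ℝ), ContDiffOn ℝ 1 (f i) (Icc 0 η) ∧ ContDiffOn ℝ 1 (f i) (Icc (1 - η) 1)
  deriv0 : ∀ i, HasDerivWithinAt (f i) (d i) (Icc 0 1) 0
  deriv1 : ∀ i, HasDerivWithinAt (f i) (e i) (Icc 0 1) 1
  dpos : ∀ i, 0 < d i
  epos : ∀ i, 0 < e i
  lyap0 : 0 < ∑ i, p i * Real.log (d i)
  lyap1 : 0 < ∑ i, p i * Real.log (e i)
  interior : ∀ x ∈ Ioo (0:ℝ) 1, (∃ i, f i x < x) ∧ (∃ j, x < f j x)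

/-- Iterates along a sequence of indices: `wordIter f ω n = f_{ω (n-1)} ∘ ⋯ ∘ f_{ω 0}`. -/
def wordIter {N : ℕ} (f : Fin N → ℝ → ℝ) (ω : ℕ → Fin N) : ℕ → ℝ → ℝ
  | 0 => id
  | n + 1 => f (ω n) ∘ wordIter f ω n

/-- `⌊n^{1/4}⌋`. -/
noncomputable def nroot4 (n : ℕ) : ℕ := ⌊(n : ℝ) ^ ((1 : ℝ) / 4)⌋₊


noncomputable def UL {N : ℕ} (f : Fin N → ℝ → ℝ) (p : Fin N → ℝ) : (ℝ → ℝ) →ₗ[ℝ] (ℝ → ℝ) where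
  toFun h := fun x => ∑ i, p i * h (f i x)
  map_add' h k := by
    funext x
    simp [mul_add, Finset.sum_add_distrib]
  map_smul' c h := by
    funext x
    simp only [Pi.smul_apply, smul_eq_mul, RingHom.id_apply, Finset.mul_sum]
    exact Finset.sum_congr rfl fun i _ => by ring

lemma UL_apply {N : ℕ} (f : Fin N → ℝ → ℝ) (p : Fin N → ℝ) (h : ℝ → ℝ) (x : ℝ) :
    UL f p h x = ∑ i, p i * h (f i x) := rfl

lemma UL_pow_succ {N : ℕ} (f : Fin N → ℝ → ℝ) (p : Fin N → ℝ) (n : ℕ) (h : ℝ → ℝ) (x : ℝ) :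
    (UL f p ^ (n+1)) h x = ∑ i, p i * (UL f p ^ n) h (f i x) := by
  rw [pow_succ', Module.End.mul_apply, UL_apply]

lemma UL_pow_mono {N : ℕ} {f : Fin N → ℝ → ℝ} {p : Fin N → ℝ} (hp : ∀ i, 0 < p i)
    (hI : ∀ i, MapsTo (f i) (Ioo 0 1) (Ioo 0 1)) {h k : ℝ → ℝ}
    (hk : ∀ x ∈ Ioo (0:ℝ) 1, h x ≤ k x) (n : ℕ) :
    ∀ x ∈ Ioo (0:ℝ) 1, (UL f p ^ n) h x ≤ (UL f p ^ n) k x := by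
  induction n with
  | zero => simpa using hk
  | succ n ih =>
    intro x hx
    rw [UL_pow_succ, UL_pow_succ]
    exact Finset.sum_le_sum fun i _ => mul_le_mul_of_nonneg_left (ih _ (hI i hx)) (hp i).le

lemma UL_pow_const {N : ℕ} {f : Fin N → ℝ → ℝ} {p : Fin N → ℝ} (hs : ∑ i, p i = 1)
    (c : ℝ) (n : ℕ) : (UL f p ^ n) (fun _ => c) = fun _ => c := by
  induction n with
  | zero => simp
  | succ n ih =>
    funext x
    rw [UL_pow_succ, ih, ← Finset.sum_mul, hs, one_mul]

lemma UL_pow_monoOn {N : ℕ} {f : Fin N → ℝ → ℝ} {p : Fin N → ℝ} (hp : ∀ i, 0 < p i)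
    (hI : ∀ i, MapsTo (f i) (Ioo 0 1) (Ioo 0 1)) (hm : ∀ i, MonotoneOn (f i) (Ioo 0 1))
    {h : ℝ → ℝ} (hh : MonotoneOn h (Ioo 0 1)) (n : ℕ) :
    MonotoneOn ((UL f p ^ n) h) (Ioo 0 1) := by
  induction n with
  | zero => simpa using hh
  | succ n ih =>
    intro x hx y hy hxy
    rw [UL_pow_succ, UL_pow_succ]
    exact Finset.sum_le_sum fun i _ =>
      mul_le_mul_of_nonneg_left (ih (hI i hx) (hI i hy) (hm i hx hy hxy)) (hp i).le

lemma UL_pow_reflect {N : ℕ} (f : Fin N → ℝ → ℝ) (p : Fin N → ℝ) (h : ℝ → ℝ) (n : ℕ) (x : ℝ) :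
    (UL (fun i x => 1 - f i (1 - x)) p ^ n) (fun x => h (1 - x)) x = (UL f p ^ n) h (1 - x) := by
  induction n generalizing x with
  | zero => simp
  | succ n ih =>
    rw [UL_pow_succ, UL_pow_succ]
    refine Finset.sum_congr rfl fun i _ => ?_
    rw [ih]; simp

lemma exists_alpha {N : ℕ} {p c : Fin N → ℝ} (hs : ∑ i, p i = 1)
    (hc : 0 < ∑ i, p i * c i) : ∃ α > 0, ∑ i, p i * Real.exp (-α * c i) < 1 := by
  have h : HasDerivAt (fun α : ℝ => ∑ i, p i * Real.exp (-α * c i)) (-∑ i, p i * c i) 0 := by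
    have : HasDerivAt (fun α : ℝ => ∑ i, p i * Real.exp (-α * c i))
        (∑ i, p i * (Real.exp (-0 * c i) * (-1 * c i))) 0 := by
      refine HasDerivAt.fun_sum fun i _ => ?_
      refine HasDerivAt.const_mul _ ?_
      refine HasDerivAt.exp ?_
      exact ((hasDerivAt_id (0:ℝ)).neg).mul_const _
    convert this using 1
    simp [← Finset.sum_neg_distrib]
  have h2 := (hasDerivAt_iff_tendsto_slope.1 h).eventually (gt_mem_nhds (show -∑ i, p i * c i < 0 by linarith))
  have h3 : ∀ᶠ a in nhdsWithin (0:ℝ) (Ioi 0), slope (fun α : ℝ => ∑ i, p i * Real.exp (-α * c i)) 0 a < 0 :=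
    h2.filter_mono (nhdsWithin_mono _ (fun x hx => ne_of_gt hx))
  obtain ⟨a, ha, ha0⟩ := (h3.and self_mem_nhdsWithin).exists
  refine ⟨a, ha0, ?_⟩
  rw [slope_def_field] at ha
  have ha0' : (0:ℝ) < a := ha0
  have := (div_neg_iff.1 ha)
  simp only [sub_zero, neg_zero, zero_mul, Real.exp_zero, mul_one, hs] at this
  rcases this with h | h <;> linarith [h.1, h.2]

lemma drift_one {N : ℕ} {f : Fin N → ℝ → ℝ} {p d : Fin N → ℝ} (hp : ∀ i, 0 < p i)
    (hs : ∑ i, p i = 1)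
    (hI : ∀ i, MapsTo (f i) (Ioo 0 1) (Ioo 0 1)) (hm : ∀ i, MonotoneOn (f i) (Ioo 0 1))
    (h0 : ∀ i, f i 0 = 0) (hd : ∀ i, HasDerivWithinAt (f i) (d i) (Icc 0 1) 0)
    (hdp : ∀ i, 0 < d i) (hl : 0 < ∑ i, p i * Real.log (d i)) :
    ∃ V : ℝ → ℝ, Measurable V ∧ (∀ x ∈ Ioo (0:ℝ) 1, 0 ≤ V x) ∧
      (∃ l C : ℝ, 0 ≤ l ∧ l < 1 ∧ 0 ≤ C ∧ ∀ x ∈ Ioo (0:ℝ) 1, UL f p V x ≤ l * V x + C) ∧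
      ∀ R : ℝ, ∃ δ > 0, ∀ x ∈ Ioo (0:ℝ) 1, V x ≤ R → δ ≤ x := by
  set lam := ∑ i, p i * Real.log (d i) with hlam
  set ε := lam / 2 with hε
  have hεp : 0 < ε := by positivity
  have hc : 0 < ∑ i, p i * (Real.log (d i) - ε) := by
    simp only [mul_sub, Finset.sum_sub_distrib, ← Finset.sum_mul, hs]
    linarith
  obtain ⟨α, hα, hα1⟩ := exists_alpha hs hc
  have hη : ∃ η ∈ Ioo (0:ℝ) 1, ∀ i, ∀ x ∈ Ioo (0:ℝ) η, d i * Real.exp (-ε) * x ≤ f i x := by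
    have : ∀ᶠ x in nhdsWithin (0:ℝ) (Ioi 0), ∀ i, d i * Real.exp (-ε) * x ≤ f i x := by
      rw [Filter.eventually_all]
      intro i
      have h1 := (hasDerivWithinAt_iff_tendsto_slope.1 (hd i)).eventually
        (lt_mem_nhds (show d i * Real.exp (-ε) < d i by
          have : Real.exp (-ε) < 1 := by simpa using Real.exp_lt_exp.2 (show -ε < 0 by linarith)
          nlinarith [hdp i]))
      have h2 : nhdsWithin (0:ℝ) (Ioi 0) ≤ nhdsWithin (0:ℝ) (Icc 0 1 \ {0}) := by
        rw [← nhdsWithin_Ioo_eq_nhdsGT (show (0:ℝ) < 1 by norm_num)]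
        exact nhdsWithin_mono _ fun x hx => ⟨⟨hx.1.le, hx.2.le⟩, ne_of_gt hx.1⟩
      filter_upwards [h1.filter_mono h2, self_mem_nhdsWithin] with x hx hx0
      have hx0' : (0:ℝ) < x := hx0
      rw [slope_def_field, h0, sub_zero, sub_zero, lt_div_iff₀ hx0'] at hx
      exact hx.le
    obtain ⟨η, hη0, hη⟩ := (mem_nhdsGT_iff_exists_Ioo_subset' (show (0:ℝ) < 1 by norm_num)).1 this
    refine ⟨min η (1/2), ⟨lt_min hη0 (by norm_num), lt_of_le_of_lt (min_le_right _ _) (by norm_num)⟩, ?_⟩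
    intro i x hx
    exact hη ⟨hx.1, hx.2.trans_le (min_le_left _ _)⟩ i
  obtain ⟨η, hη01, hη⟩ := hη
  refine ⟨fun x => x ^ (-α), by fun_prop, fun x hx => Real.rpow_nonneg hx.1.le _,
    ⟨∑ i, p i * Real.exp (-α * (Real.log (d i) - ε)), ∑ i, p i * (f i η) ^ (-α), ?_, hα1, ?_, ?_⟩, ?_⟩
  · exact Finset.sum_nonneg fun i _ => mul_nonneg (hp i).le (Real.exp_pos _).le
  · exact Finset.sum_nonneg fun i _ => mul_nonneg (hp i).le (Real.rpow_nonneg (hI i hη01).1.le _)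
  · intro x hx
    have e1 : 0 ≤ (∑ i, p i * Real.exp (-α * (Real.log (d i) - ε))) * x ^ (-α) :=
      mul_nonneg (Finset.sum_nonneg fun i _ => mul_nonneg (hp i).le (Real.exp_pos _).le)
        (Real.rpow_nonneg hx.1.le _)
    have e2 : 0 ≤ ∑ i, p i * (f i η) ^ (-α) :=
      Finset.sum_nonneg fun i _ => mul_nonneg (hp i).le (Real.rpow_nonneg (hI i hη01).1.le _)
    rw [UL_apply]
    rcases lt_or_ge x η with hxη | hxη
    · refine le_trans ?_ (le_add_of_nonneg_right e2)
      rw [Finset.sum_mul]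
      refine Finset.sum_le_sum fun i _ => ?_
      rw [mul_assoc]
      refine mul_le_mul_of_nonneg_left ?_ (hp i).le
      have hdx : 0 < d i * Real.exp (-ε) := mul_pos (hdp i) (Real.exp_pos _)
      calc f i x ^ (-α) ≤ (d i * Real.exp (-ε) * x) ^ (-α) :=
            Real.rpow_le_rpow_of_nonpos (mul_pos hdx hx.1) (hη i x ⟨hx.1, hxη⟩) (by linarith)
        _ = (d i * Real.exp (-ε)) ^ (-α) * x ^ (-α) := Real.mul_rpow hdx.le hx.1.le
        _ = _ := by
          congr 1
          rw [Real.rpow_def_of_pos hdx, Real.log_mul (hdp i).ne' (Real.exp_pos _).ne', Real.log_exp]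
          congr 1; ring
    · refine le_trans ?_ (le_add_of_nonneg_left e1)
      refine Finset.sum_le_sum fun i _ => mul_le_mul_of_nonneg_left ?_ (hp i).le
      exact Real.rpow_le_rpow_of_nonpos (hI i hη01).1 (hm i hη01 hx hxη) (by linarith)
  · intro R
    refine ⟨(max R 1) ^ (-α⁻¹), by positivity, fun x hx hxR => ?_⟩
    have h1 : (max R 1) ^ (-α⁻¹) ≤ (x ^ (-α)) ^ (-α⁻¹) :=
      Real.rpow_le_rpow_of_nonpos (Real.rpow_pos_of_pos hx.1 _) (hxR.trans (le_max_left _ _))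
        (by have := inv_pos.2 hα; linarith)
    rwa [← Real.rpow_mul hx.1.le, neg_mul_neg, mul_inv_cancel₀ hα.ne', Real.rpow_one] at h1

lemma split_one {N : ℕ} {f : Fin N → ℝ → ℝ} {p : Fin N → ℝ} (hp : ∀ i, 0 < p i)
    (hI : ∀ i, MapsTo (f i) (Ioo 0 1) (Ioo 0 1)) (hm : ∀ i, MonotoneOn (f i) (Ioo 0 1))
    (hc : ∀ i, ContinuousOn (f i) (Icc 0 1))
    (hint : ∀ x ∈ Ioo (0:ℝ) 1, ∃ i, f i x < x) (y : ℝ) (hy : y ∈ Ioo (0:ℝ) 1) :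
    ∃ m₀ : ℕ, ∀ m ≥ m₀, 0 < (UL f p ^ m) (fun x => if x ≤ 1/2 then 1 else 0) y := by
  set h : ℝ → ℝ := fun x => if x ≤ 1/2 then 1 else 0 with hh
  have hnn : ∀ n, ∀ x ∈ Ioo (0:ℝ) 1, 0 ≤ (UL f p ^ n) h x := by
    intro n
    induction n with
    | zero => intro x _; simp only [pow_zero, Module.End.one_apply, hh]; split_ifs <;> norm_num
    | succ n ih =>
      intro x hx
      rw [UL_pow_succ]
      exact Finset.sum_nonneg fun i _ => mul_nonneg (hp i).le (ih _ (hI i hx))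
  have step : ∀ n, ∀ x ∈ Ioo (0:ℝ) 1, ∀ i, 0 < (UL f p ^ n) h (f i x) → 0 < (UL f p ^ (n+1)) h x := by
    intro n x hx i hi
    rw [UL_pow_succ]
    exact Finset.sum_pos' (fun j _ => mul_nonneg (hp j).le (hnn n _ (hI j hx)))
      ⟨i, Finset.mem_univ _, mul_pos (hp i) hi⟩
  have low : ∀ n, ∀ x ∈ Ioo (0:ℝ) 1, x ≤ 1/2 → 0 < (UL f p ^ n) h x := by
    intro n
    induction n with
    | zero => intro x _ hx; simp only [pow_zero, Module.End.one_apply, hh]; rw [if_pos hx]; norm_num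
    | succ n ih =>
      intro x hx hx2
      obtain ⟨i, hi⟩ := hint x hx
      exact step n x hx i (ih _ (hI i hx) (hi.le.trans hx2))
  let S : Set ℝ := {y | y ∈ Ioo (0:ℝ) 1 ∧ ∃ m₀ : ℕ, ∀ m ≥ m₀, 0 < (UL f p ^ m) h y}
  have hStep : ∀ x ∈ Ioo (0:ℝ) 1, ∀ i, f i x ∈ S → x ∈ S := by
    rintro x hx i ⟨_, m₀, h1⟩
    refine ⟨hx, m₀ + 1, fun m hm => ?_⟩
    obtain ⟨k, rfl⟩ : ∃ k, m = k + 1 := ⟨m - 1, by omega⟩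
    exact step k x hx i (h1 k (by omega))
  have hanti : ∀ n, AntitoneOn ((UL f p ^ n) h) (Ioo 0 1) := by
    intro n
    have : MonotoneOn ((UL f p ^ n) (-h)) (Ioo 0 1) := by
      refine UL_pow_monoOn hp hI hm ?_ n
      intro a _ b _ hab
      simp only [hh, Pi.neg_apply]
      split_ifs <;> first | (exfalso; linarith) | norm_num
    rw [map_neg] at this
    intro a ha b hb hab
    have := this ha hb hab
    simp only [Pi.neg_apply] at this
    linarith
  have hdown : ∀ a ∈ Ioo (0:ℝ) 1, ∀ b ∈ S, a ≤ b → a ∈ S := by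
    rintro a ha b ⟨hb, m₀, h1⟩ hab
    exact ⟨ha, m₀, fun m hm => (h1 m hm).trans_le (hanti m ha hb hab)⟩
  have hhalf : (1/2:ℝ) ∈ S := ⟨by norm_num, 0, fun m _ => low m _ (by norm_num) le_rfl⟩
  have hbdd : BddAbove S := ⟨1, fun x hx => hx.1.2.le⟩
  suffices hyS : y ∈ S from hyS.2
  by_contra hyS
  have hsy : sSup S ≤ y := csSup_le ⟨_, hhalf⟩ fun b hb => by
    by_contra hlt
    exact hyS (hdown y hy b hb (not_le.1 hlt).le)
  set s := sSup S with hs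
  have hs2 : 1/2 ≤ s := le_csSup hbdd hhalf
  have hs01 : s ∈ Ioo (0:ℝ) 1 := ⟨by linarith, hsy.trans_lt hy.2⟩
  obtain ⟨i, hi⟩ := hint s hs01
  have hcont : ContinuousAt (f i) s := (hc i).continuousAt (Icc_mem_nhds hs01.1 hs01.2)
  have hev : ∀ᶠ x in nhds s, f i x < s ∧ x ∈ Ioo (0:ℝ) 1 :=
    (hcont.eventually (gt_mem_nhds hi)).and (Ioo_mem_nhds hs01.1 hs01.2)
  have hev2 : ∀ᶠ x in nhdsWithin s (Ioi s), f i x < s ∧ x ∈ Ioo (0:ℝ) 1 := hev.filter_mono nhdsWithin_le_nhds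
  obtain ⟨t, ⟨ht1, ht2⟩, ht3⟩ := (hev2.and self_mem_nhdsWithin).exists
  have hts : t ∈ S := by
    obtain ⟨b, hb, hb2⟩ := exists_lt_of_lt_csSup ⟨_, hhalf⟩ ht1
    exact hStep t ht2 i (hdown _ (hI i ht2) b hb hb2.le)
  exact absurd (le_csSup hbdd hts) (not_le.2 ht3)

lemma drift_two {N : ℕ} {f : Fin N → ℝ → ℝ} {p d e : Fin N → ℝ} (H : AdmissibleIFS N f p d e)
    (hI : ∀ i, MapsTo (f i) (Ioo 0 1) (Ioo 0 1)) (hm : ∀ i, MonotoneOn (f i) (Ioo 0 1)) :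
    ∃ V : ℝ → ℝ, Measurable V ∧ (∀ x ∈ Ioo (0:ℝ) 1, 0 ≤ V x) ∧
      (∃ l C : ℝ, 0 ≤ l ∧ l < 1 ∧ 0 ≤ C ∧ ∀ x ∈ Ioo (0:ℝ) 1, UL f p V x ≤ l * V x + C) ∧
      ∀ R : ℝ, ∃ δ ∈ Ioo (0:ℝ) 1, ∀ x ∈ Ioo (0:ℝ) 1, V x ≤ R → δ ≤ x ∧ x ≤ 1 - δ := by
  obtain ⟨V, hV, hV0, ⟨l, C, hl0, hl1, hC, hdr⟩, hR⟩ :=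
    drift_one H.ppos H.psum hI hm H.fix0 H.deriv0 H.dpos H.lyap0
  have refl01 : ∀ x ∈ Ioo (0:ℝ) 1, 1 - x ∈ Ioo (0:ℝ) 1 := fun x hx => ⟨by linarith [hx.2], by linarith [hx.1]⟩
  obtain ⟨V', hV', hV0', ⟨l', C', hl0', hl1', hC', hdr'⟩, hR'⟩ :=
    drift_one (f := fun i x => 1 - f i (1 - x)) (d := e) H.ppos H.psum
      (fun i x hx => refl01 _ (hI i (refl01 x hx)))
      (fun i x hx y hy hxy => by
        have := hm i (refl01 y hy) (refl01 x hx) (by linarith)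
        simp only; linarith)
      (fun i => by simp [H.fix1])
      (fun i => by
        have h1 : HasDerivWithinAt (f i) (e i) (Icc 0 1) (1 - 0) := by simpa using H.deriv1 i
        have h2 : HasDerivWithinAt (fun x : ℝ => 1 - x) (-1) (Icc 0 1) 0 := by
          simpa using ((hasDerivWithinAt_id (0:ℝ) (Icc 0 1)).const_sub 1)
        have h3 := (h1.comp (0:ℝ) h2 (fun x hx => ⟨by linarith [hx.2], by linarith [hx.1]⟩)).const_sub 1
        simpa [Function.comp_def] using h3)
      H.epos H.lyap1
  have key : ∀ x, UL f p (fun x => V' (1 - x)) x = UL (fun i x => 1 - f i (1 - x)) p V' (1 - x) := by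
    intro x; simp [UL_apply]
  refine ⟨fun x => V x + V' (1 - x), by fun_prop, fun x hx => add_nonneg (hV0 x hx) (hV0' _ (refl01 x hx)),
    ⟨max l l', C + C', le_max_of_le_left hl0, max_lt hl1 hl1', add_nonneg hC hC', ?_⟩, ?_⟩
  · intro x hx
    have e1 : UL f p (fun x => V x + V' (1 - x)) x = UL f p V x + UL f p (fun x => V' (1 - x)) x := by
      simp [UL_apply, mul_add, Finset.sum_add_distrib]
    rw [e1, key]
    have a1 := hdr x hx
    have a2 := hdr' _ (refl01 x hx)
    have b1 := mul_le_mul_of_nonneg_right (le_max_left l l') (hV0 x hx)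
    have b2 := mul_le_mul_of_nonneg_right (le_max_right l l') (hV0' _ (refl01 x hx))
    simp only [mul_add]
    linarith
  · intro R
    obtain ⟨δ, hδ, h1⟩ := hR R
    obtain ⟨δ', hδ', h1'⟩ := hR' R
    refine ⟨min (1/2) (min δ δ'), ⟨by positivity, lt_of_le_of_lt (min_le_left _ _) (by norm_num)⟩, ?_⟩
    intro x hx hxR
    have q1 := h1 x hx (by have := hV0' _ (refl01 x hx); simp only at hxR; linarith)
    have q2 := h1' _ (refl01 x hx) (by have := hV0 _ hx; simp only at hxR; linarith)
    have m1 : min (1/2) (min δ δ') ≤ δ := (min_le_right _ _).trans (min_le_left _ _)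
    have m2 : min (1/2) (min δ δ') ≤ δ' := (min_le_right _ _).trans (min_le_right _ _)
    constructor <;> linarith

lemma drift_pow {N : ℕ} {f : Fin N → ℝ → ℝ} {p : Fin N → ℝ} (hp : ∀ i, 0 < p i)
    (hs : ∑ i, p i = 1) (hI : ∀ i, MapsTo (f i) (Ioo 0 1) (Ioo 0 1))
    {V : ℝ → ℝ} {l C : ℝ} (hl0 : 0 ≤ l) (hl1 : l < 1)
    (hdr : ∀ x ∈ Ioo (0:ℝ) 1, UL f p V x ≤ l * V x + C) (m : ℕ) :
    ∀ x ∈ Ioo (0:ℝ) 1, (UL f p ^ m) V x ≤ l ^ m * V x + C / (1 - l) * (1 - l ^ m) := by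
  have hl : 0 < 1 - l := by linarith
  induction m with
  | zero => intro x hx; simp
  | succ m ih =>
    intro x hx
    rw [UL_pow_succ]
    have h1 : ∑ i, p i * (UL f p ^ m) V (f i x)
        ≤ ∑ i, p i * (l ^ m * V (f i x) + C / (1 - l) * (1 - l ^ m)) :=
      Finset.sum_le_sum fun i _ => mul_le_mul_of_nonneg_left (ih _ (hI i hx)) (hp i).le
    have h2 : ∑ i, p i * (l ^ m * V (f i x) + C / (1 - l) * (1 - l ^ m))
        = l ^ m * UL f p V x + C / (1 - l) * (1 - l ^ m) := by
      simp only [mul_add, Finset.sum_add_distrib, ← Finset.sum_mul, hs, one_mul, UL_apply, Finset.mul_sum]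
      congr 1
      exact Finset.sum_congr rfl fun i _ => by ring
    have h6 : l ^ m * UL f p V x ≤ l ^ m * (l * V x + C) :=
      mul_le_mul_of_nonneg_left (hdr x hx) (pow_nonneg hl0 m)
    have h3 : l ^ m * (l * V x + C) + C / (1 - l) * (1 - l ^ m)
        = l ^ (m+1) * V x + C / (1 - l) * (1 - l ^ (m+1)) := by field_simp; ring
    linarith

lemma numeric {l C ε : ℝ} (hl1 : l < 1) (hC : 0 ≤ C) (hε : 0 < ε) :
    ∃ β ρ : ℝ, 0 < β ∧ 0 < ρ ∧ ρ < 1 ∧ ∀ S κ : ℝ, 0 ≤ S → 0 ≤ κ →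
      (S ≤ (4 * C + 2) / (1 - l) → ε ≤ κ) →
      1 + β * (l * S + 2 * C) - κ ≤ ρ * (1 + β * S) := by
  have hl : 0 < 1 - l := by linarith
  set β := ε / (4 * C + 1) with hβ
  have hβp : 0 < β := by positivity
  have hβC : β * (4 * C + 1) = ε := by rw [hβ]; field_simp
  refine ⟨β, max (max (1 - ε/2) ((1 + l)/2)) (max (1 - β) (1/2)), hβp, by positivity, ?_, ?_⟩
  · refine max_lt (max_lt (by linarith) (by linarith)) (max_lt (by linarith) (by norm_num))
  · intro S κ hS hκ hR
    set ρ := max (max (1 - ε/2) ((1 + l)/2)) (max (1 - β) (1/2)) with hρ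
    have r1 : 1 - ε/2 ≤ ρ := (le_max_left _ _).trans (le_max_left _ _)
    have r2 : (1 + l)/2 ≤ ρ := (le_max_right _ _).trans (le_max_left _ _)
    have r3 : 1 - β ≤ ρ := (le_max_left _ _).trans (le_max_right _ _)
    have hβS : 0 ≤ β * S := by positivity
    have r4 : (1 + l)/2 * (β * S) ≤ ρ * (β * S) := mul_le_mul_of_nonneg_right r2 hβS
    have r5 : l * (β * S) ≤ (1 + l)/2 * (β * S) := mul_le_mul_of_nonneg_right (by linarith) hβS
    by_cases hc : S ≤ (4 * C + 2) / (1 - l)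
    · have := hR hc
      nlinarith
    · rw [not_le, div_lt_iff₀ hl] at hc
      have : β * (4 * C + 2) ≤ β * (S * (1 - l)) := mul_le_mul_of_nonneg_left hc.le hβp.le
      nlinarith

lemma contr_step {N : ℕ} {f : Fin N → ℝ → ℝ} {p : Fin N → ℝ} (hp : ∀ i, 0 < p i)
    (hs : ∑ i, p i = 1) (hI : ∀ i, MapsTo (f i) (Ioo 0 1) (Ioo 0 1))
    {V h : ℝ → ℝ} (hV0 : ∀ x ∈ Ioo (0:ℝ) 1, 0 ≤ V x) (hh : MonotoneOn h (Ioo 0 1))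
    {a β : ℝ} (ha : 0 ≤ a) (hβ : 0 ≤ β)
    (hb : ∀ x ∈ Ioo (0:ℝ) 1, ∀ y ∈ Ioo (0:ℝ) 1, h y - h x ≤ a * (1 + β * (V x + V y))) (m : ℕ) :
    ∀ x ∈ Ioo (0:ℝ) 1, ∀ y ∈ Ioo (0:ℝ) 1, (UL f p ^ m) h y - (UL f p ^ m) h x
      ≤ a * (1 + β * ((UL f p ^ m) V x + (UL f p ^ m) V y)
        - (UL f p ^ m) (fun x => if 1/2 ≤ x then 1 else 0) x
          * (UL f p ^ m) (fun x => if x ≤ 1/2 then 1 else 0) y) := by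
  set c1 : ℝ → ℝ := fun x => if 1/2 ≤ x then 1 else 0 with hc1
  set c2 : ℝ → ℝ := fun x => if x ≤ 1/2 then 1 else 0 with hc2
  have hb' : ∀ x ∈ Ioo (0:ℝ) 1, ∀ y ∈ Ioo (0:ℝ) 1,
      h y - h x ≤ a * (1 + β * (V x + V y) - c1 x * c2 y) := by
    intro x hx y hy
    simp only [hc1, hc2]
    split_ifs with h1 h2
    · have := hh hy hx (h2.trans h1)
      have h3 : 0 ≤ a * (β * (V x + V y)) :=
        mul_nonneg ha (mul_nonneg hβ (add_nonneg (hV0 x hx) (hV0 y hy)))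
      nlinarith
    all_goals simpa using hb x hx y hy
  have s1 : ∀ y ∈ Ioo (0:ℝ) 1, ∀ x ∈ Ioo (0:ℝ) 1,
      h y - (UL f p ^ m) h x ≤ a * (1 + β * ((UL f p ^ m) V x + V y) - (UL f p ^ m) c1 x * c2 y) := by
    intro y hy x hx
    have := UL_pow_mono hp hI (h := (fun _ => h y) - h)
      (k := (fun _ => a * (1 + β * V y)) + (a * β) • V - (a * c2 y) • c1)
      (fun x hx => by
        have := hb' x hx y hy
        simp only [Pi.sub_apply, Pi.add_apply, Pi.smul_apply, smul_eq_mul]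
        linarith) m x hx
    simp only [map_sub, map_add, map_smul, UL_pow_const hs, Pi.sub_apply, Pi.add_apply,
      Pi.smul_apply, smul_eq_mul] at this
    linarith
  intro x hx y hy
  have := UL_pow_mono hp hI (h := h - (fun _ => (UL f p ^ m) h x))
      (k := (fun _ => a * (1 + β * (UL f p ^ m) V x)) + (a * β) • V - (a * (UL f p ^ m) c1 x) • c2)
      (fun y hy => by
        have := s1 y hy x hx
        simp only [Pi.sub_apply, Pi.add_apply, Pi.smul_apply, smul_eq_mul]
        linarith) m y hy
  simp only [map_sub, map_add, map_smul, UL_pow_const hs, Pi.sub_apply, Pi.add_apply,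
      Pi.smul_apply, smul_eq_mul] at this
  linarith

lemma contraction {N : ℕ} {f : Fin N → ℝ → ℝ} {p d e : Fin N → ℝ} (H : AdmissibleIFS N f p d e)
    (hI : ∀ i, MapsTo (f i) (Ioo 0 1) (Ioo 0 1)) (hm : ∀ i, MonotoneOn (f i) (Ioo 0 1)) :
    ∃ V : ℝ → ℝ, Measurable V ∧ (∀ x ∈ Ioo (0:ℝ) 1, 0 ≤ V x) ∧
      (∃ l C : ℝ, 0 ≤ l ∧ l < 1 ∧ 0 ≤ C ∧ ∀ x ∈ Ioo (0:ℝ) 1, UL f p V x ≤ l * V x + C) ∧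
      ∃ r A : ℝ, 0 < r ∧ r < 1 ∧ 0 ≤ A ∧ ∀ n : ℕ, ∀ x ∈ Ioo (0:ℝ) 1, ∀ y ∈ Ioo (0:ℝ) 1,
        (UL f p ^ n) id y - (UL f p ^ n) id x ≤ A * r ^ n * (1 + V x + V y) := by
  obtain ⟨V, hV, hV0, ⟨l, C, hl0, hl1, hC, hdr⟩, hR⟩ := drift_two H hI hm
  refine ⟨V, hV, hV0, ⟨l, C, hl0, hl1, hC, hdr⟩, ?_⟩
  have hl : 0 < 1 - l := by linarith
  set C' := C / (1 - l) with hC'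
  have hC'0 : 0 ≤ C' := div_nonneg hC hl.le
  obtain ⟨δ, hδ, hδR⟩ := hR ((4 * C' + 2) / (1 - l))
  have refl01 : ∀ x ∈ Ioo (0:ℝ) 1, 1 - x ∈ Ioo (0:ℝ) 1 := fun x hx => ⟨by linarith [hx.2], by linarith [hx.1]⟩
  have hp := H.ppos
  obtain ⟨m₁, hm₁⟩ := split_one hp hI hm H.cont (fun x hx => (H.interior x hx).1) (1 - δ) (refl01 _ hδ)
  obtain ⟨m₂, hm₂⟩ := split_one (f := fun i x => 1 - f i (1 - x)) hp
      (fun i x hx => refl01 _ (hI i (refl01 x hx)))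
      (fun i x hx y hy hxy => by
        have := hm i (refl01 y hy) (refl01 x hx) (by linarith)
        simp only; linarith)
      (fun i => by
        refine continuousOn_const.sub ((H.cont i).comp (by fun_prop) ?_)
        exact fun x hx => ⟨by linarith [hx.2], by linarith [hx.1]⟩)
      (fun x hx => by
        obtain ⟨i, hi⟩ := (H.interior _ (refl01 x hx)).2
        exact ⟨i, by linarith⟩) (1 - δ) (refl01 _ hδ)
  set m := max (max m₁ m₂) 1 with hmdef
  have hmm1 : m₁ ≤ m := (le_max_left _ _).trans (le_max_left _ _)
  have hmm2 : m₂ ≤ m := (le_max_right _ _).trans (le_max_left _ _)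
  have hmm3 : 1 ≤ m := le_max_right _ _
  set c1 : ℝ → ℝ := fun x => if 1/2 ≤ x then 1 else 0 with hc1
  set c2 : ℝ → ℝ := fun x => if x ≤ 1/2 then 1 else 0 with hc2
  have k2 : 0 < (UL f p ^ m) c2 (1 - δ) := hm₁ m hmm1
  have k1 : 0 < (UL f p ^ m) c1 δ := by
    have := hm₂ m hmm2
    have e1 : c2 = fun x => c1 (1 - x) := by
      funext x
      simp only [hc1, hc2]
      congr 1
      rw [eq_iff_iff]; constructor <;> intro _ <;> linarith
    rw [e1, UL_pow_reflect] at this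
    simpa using this
  have mono1 : MonotoneOn ((UL f p ^ m) c1) (Ioo 0 1) := by
    refine UL_pow_monoOn hp hI hm ?_ m
    intro a _ b _ hab
    simp only [hc1]
    split_ifs <;> first | (exfalso; linarith) | norm_num
  have mono2 : AntitoneOn ((UL f p ^ m) c2) (Ioo 0 1) := by
    have : MonotoneOn ((UL f p ^ m) (-c2)) (Ioo 0 1) := by
      refine UL_pow_monoOn hp hI hm ?_ m
      intro a _ b _ hab
      simp only [hc2, Pi.neg_apply]
      split_ifs <;> first | (exfalso; linarith) | norm_num
    rw [map_neg] at this
    intro a ha b hb hab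
    have := this ha hb hab
    simp only [Pi.neg_apply] at this
    linarith
  have nn1 : ∀ x ∈ Ioo (0:ℝ) 1, 0 ≤ (UL f p ^ m) c1 x := by
    intro x hx
    have := UL_pow_mono hp hI (h := fun _ => 0) (k := c1)
      (fun x _ => by simp only [hc1]; split_ifs <;> norm_num) m x hx
    rwa [UL_pow_const H.psum] at this
  have nn2 : ∀ x ∈ Ioo (0:ℝ) 1, 0 ≤ (UL f p ^ m) c2 x := by
    intro x hx
    have := UL_pow_mono hp hI (h := fun _ => 0) (k := c2)
      (fun x _ => by simp only [hc2]; split_ifs <;> norm_num) m x hx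
    rwa [UL_pow_const H.psum] at this
  obtain ⟨β, ρ, hβ, hρ0, hρ1, hnum⟩ := numeric (C := C') hl1 hC'0 (mul_pos k1 k2)
  have hdm : ∀ x ∈ Ioo (0:ℝ) 1, (UL f p ^ m) V x ≤ l * V x + C' := by
    intro x hx
    have h1 := drift_pow hp H.psum hI hl0 hl1 hdr m x hx
    have h2 : l ^ m ≤ l := by simpa using pow_le_pow_of_le_one hl0 hl1.le hmm3
    have h3 : l ^ m * V x ≤ l * V x := mul_le_mul_of_nonneg_right h2 (hV0 x hx)
    have h4 : C' * (1 - l ^ m) ≤ C' := by nlinarith [pow_nonneg hl0 m]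
    linarith
  have hmono : ∀ n, MonotoneOn ((UL f p ^ n) id) (Ioo 0 1) :=
    fun n => UL_pow_monoOn hp hI hm (fun a _ b _ hab => hab) n
  have step : ∀ n : ℕ, ∀ a : ℝ, 0 ≤ a → (∀ x ∈ Ioo (0:ℝ) 1, ∀ y ∈ Ioo (0:ℝ) 1,
        (UL f p ^ n) id y - (UL f p ^ n) id x ≤ a * (1 + β * (V x + V y))) →
      ∀ x ∈ Ioo (0:ℝ) 1, ∀ y ∈ Ioo (0:ℝ) 1,
        (UL f p ^ (m + n)) id y - (UL f p ^ (m + n)) id x ≤ (ρ * a) * (1 + β * (V x + V y)) := by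
    intro n a ha hb x hx y hy
    have h1 := contr_step hp H.psum hI hV0 (hmono n) ha hβ.le hb m x hx y hy
    rw [pow_add, Module.End.mul_apply]
    refine h1.trans ?_
    rw [mul_comm ρ a, mul_assoc]
    refine mul_le_mul_of_nonneg_left ?_ ha
    refine le_trans ?_ (hnum (V x + V y) ((UL f p ^ m) c1 x * (UL f p ^ m) c2 y)
      (add_nonneg (hV0 x hx) (hV0 y hy)) (mul_nonneg (nn1 x hx) (nn2 y hy)) ?_)
    · have := hdm x hx
      have := hdm y hy
      have : β * ((UL f p ^ m) V x + (UL f p ^ m) V y) ≤ β * (l * (V x + V y) + 2 * C') :=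
        mul_le_mul_of_nonneg_left (by linarith) hβ.le
      linarith
    · intro hS
      have q1 := (hδR x hx (by linarith [hV0 y hy])).1
      have q2 := (hδR y hy (by linarith [hV0 x hx])).2
      exact mul_le_mul (mono1 hδ hx q1) (mono2 hy (refl01 _ hδ) q2) k2.le (nn1 x hx)
  have base : ∀ n : ℕ, ∀ x ∈ Ioo (0:ℝ) 1, ∀ y ∈ Ioo (0:ℝ) 1,
        (UL f p ^ n) id y - (UL f p ^ n) id x ≤ 1 * (1 + β * (V x + V y)) := by
    intro n x hx y hy
    have a1 := UL_pow_mono hp hI (h := fun _ => 0) (k := id) (fun x hx => hx.1.le) n x hx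
    have a2 := UL_pow_mono hp hI (h := id) (k := fun _ => 1) (fun x hx => hx.2.le) n y hy
    rw [UL_pow_const H.psum] at a1 a2
    have : 0 ≤ β * (V x + V y) := mul_nonneg hβ.le (add_nonneg (hV0 x hx) (hV0 y hy))
    linarith
  have all : ∀ j n : ℕ, ∀ x ∈ Ioo (0:ℝ) 1, ∀ y ∈ Ioo (0:ℝ) 1,
        (UL f p ^ (m * j + n)) id y - (UL f p ^ (m * j + n)) id x ≤ ρ ^ j * (1 + β * (V x + V y)) := by
    intro j n
    induction j with
    | zero => simpa using base n
    | succ j ih =>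
      have := step _ _ (pow_nonneg hρ0.le j) ih
      rw [pow_succ', show m * (j + 1) + n = m + (m * j + n) by ring]
      exact this
  have hm0 : (m:ℝ) ≠ 0 := by positivity
  set r := ρ ^ ((m:ℝ)⁻¹) with hr
  have hr0 : 0 < r := Real.rpow_pos_of_pos hρ0 _
  have hr1 : r < 1 := Real.rpow_lt_one hρ0.le hρ1 (by positivity)
  have hrm : r ^ m = ρ := by
    rw [hr]; exact Real.rpow_inv_natCast_pow hρ0.le (by omega)
  refine ⟨r, ρ⁻¹ * (1 + β), hr0, hr1, by positivity, fun n x hx y hy => ?_⟩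
  have h1 := all (n / m) (n % m) x hx y hy
  rw [Nat.div_add_mod] at h1
  have h2 : ρ ^ (n / m) ≤ ρ⁻¹ * r ^ n := by
    rw [le_inv_mul_iff₀ hρ0]
    conv_rhs => rw [← Nat.div_add_mod n m, pow_add, pow_mul, hrm]
    rw [mul_comm]
    refine mul_le_mul_of_nonneg_left ?_ (pow_nonneg hρ0.le _)
    rw [← hrm]
    exact pow_le_pow_of_le_one hr0.le hr1.le (Nat.mod_lt _ (by omega)).le
  have hvv := add_nonneg (hV0 x hx) (hV0 y hy)
  have h3 : 1 + β * (V x + V y) ≤ (1 + β) * (1 + V x + V y) := by nlinarith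
  calc _ ≤ ρ ^ (n / m) * (1 + β * (V x + V y)) := h1
    _ ≤ (ρ⁻¹ * r ^ n) * ((1 + β) * (1 + V x + V y)) := by
        refine mul_le_mul h2 h3 (by positivity) (by positivity)
    _ = _ := by ring

lemma adm_maps {N : ℕ} {f : Fin N → ℝ → ℝ} {p d e : Fin N → ℝ} (H : AdmissibleIFS N f p d e)
    (i : Fin N) : MapsTo (f i) (Ioo 0 1) (Ioo 0 1) := by
  intro x hx
  have h0 := H.mono i (left_mem_Icc.2 zero_le_one) (Ioo_subset_Icc_self hx) hx.1
  have h1 := H.mono i (Ioo_subset_Icc_self hx) (right_mem_Icc.2 zero_le_one) hx.2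
  rw [H.fix0] at h0
  rw [H.fix1] at h1
  exact ⟨h0, h1⟩

lemma adm_mono {N : ℕ} {f : Fin N → ℝ → ℝ} {p d e : Fin N → ℝ} (H : AdmissibleIFS N f p d e)
    (i : Fin N) : MonotoneOn (f i) (Ioo 0 1) :=
  (H.mono i).monotoneOn.mono Ioo_subset_Icc_self

lemma UL_measurable {N : ℕ} {f : Fin N → ℝ → ℝ} {p : Fin N → ℝ} (hf : ∀ i, Measurable (f i))
    {h : ℝ → ℝ} (hh : Measurable h) : Measurable (UL f p h) := by
  have : UL f p h = fun x => ∑ i, p i * h (f i x) := rfl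
  rw [this]
  exact Finset.measurable_fun_sum _ fun i _ => (hh.comp (hf i)).const_mul _

lemma UL_pow_measurable {N : ℕ} {f : Fin N → ℝ → ℝ} {p : Fin N → ℝ} (hf : ∀ i, Measurable (f i))
    {h : ℝ → ℝ} (hh : Measurable h) (n : ℕ) : Measurable ((UL f p ^ n) h) := by
  induction n with
  | zero => simpa using hh
  | succ n ih => rw [pow_succ', Module.End.mul_apply]; exact UL_measurable hf ih

lemma inv_integrable {N : ℕ} {f : Fin N → ℝ → ℝ} {p : Fin N → ℝ} (hf : ∀ i, Measurable (f i))
    (hp : ∀ i, 0 < p i) {μ : Measure ℝ}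
    (hinv : (∑ i, ENNReal.ofReal (p i) • Measure.map (f i) μ) = μ) {h : ℝ → ℝ}
    (hh : Integrable h μ) (i : Fin N) :
    Integrable h (Measure.map (f i) μ) := by
  rw [← hinv, integrable_finsetSum_measure] at hh
  have := hh i (Finset.mem_univ _)
  rwa [integrable_smul_measure] at this
  · simpa using hp i
  · simp

lemma inv_integrable' {N : ℕ} {f : Fin N → ℝ → ℝ} {p : Fin N → ℝ} (hf : ∀ i, Measurable (f i))
    (hp : ∀ i, 0 < p i) {μ : Measure ℝ}
    (hinv : (∑ i, ENNReal.ofReal (p i) • Measure.map (f i) μ) = μ) {h : ℝ → ℝ}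
    (hh : Integrable h μ) (i : Fin N) :
    Integrable (fun x => h (f i x)) μ :=
  (inv_integrable hf hp hinv hh i).comp_measurable (hf i)

lemma inv_UL {N : ℕ} {f : Fin N → ℝ → ℝ} {p : Fin N → ℝ} (hf : ∀ i, Measurable (f i))
    (hp : ∀ i, 0 < p i) {μ : Measure ℝ}
    (hinv : (∑ i, ENNReal.ofReal (p i) • Measure.map (f i) μ) = μ) {h : ℝ → ℝ}
    (hh : Integrable h μ) : Integrable (UL f p h) μ ∧ ∫ x, UL f p h x ∂μ = ∫ x, h x ∂μ := by
  have h1 := fun i => inv_integrable hf hp hinv hh i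
  have h2 := fun i => inv_integrable' hf hp hinv hh i
  constructor
  · have : UL f p h = fun x => ∑ i, p i * h (f i x) := rfl
    rw [this]
    exact integrable_finsetSum _ fun i _ => (h2 i).const_mul _
  · simp only [UL_apply]
    rw [integral_finsetSum _ fun i _ => (h2 i).const_mul _]
    conv_rhs => rw [← hinv]
    rw [integral_finsetSum_measure]
    · refine Finset.sum_congr rfl fun i _ => ?_
      rw [integral_smul_measure, integral_const_mul, integral_map (hf i).aemeasurable (h1 i).aestronglyMeasurable,
        ENNReal.toReal_ofReal (hp i).le, smul_eq_mul]
    · intro i _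
      exact (h1 i).smul_measure (by simp)

lemma V_integrable {N : ℕ} {f : Fin N → ℝ → ℝ} {p : Fin N → ℝ} (hf : ∀ i, Measurable (f i))
    (hp : ∀ i, 0 < p i) (hs : ∑ i, p i = 1) (hI : ∀ i, MapsTo (f i) (Ioo 0 1) (Ioo 0 1))
    {μ : Measure ℝ} [IsProbabilityMeasure μ]
    (hinv : (∑ i, ENNReal.ofReal (p i) • Measure.map (f i) μ) = μ)
    (hae : ∀ᵐ x ∂μ, x ∈ Ioo (0:ℝ) 1)
    {V : ℝ → ℝ} (hVm : Measurable V) (hV0 : ∀ x ∈ Ioo (0:ℝ) 1, 0 ≤ V x) {l C : ℝ} (hl0 : 0 ≤ l)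
    (hl1 : l < 1) (hC : 0 ≤ C)
    (hdr : ∀ x ∈ Ioo (0:ℝ) 1, UL f p V x ≤ l * V x + C) : Integrable V μ := by
  have hl : 0 < 1 - l := by linarith
  have key : ∀ M : ℕ, ∫⁻ x, ENNReal.ofReal (if V x ≤ M then V x else 0) ∂μ ≤ ENNReal.ofReal (C / (1 - l)) := by
    intro M
    have hM : (0:ℝ) ≤ M := Nat.cast_nonneg M
    have hmeas : Measurable fun x => if V x ≤ M then V x else 0 :=
      Measurable.ite (measurableSet_le hVm measurable_const) hVm measurable_const
    have i1 : Integrable (fun x => min (V x) M) μ := by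
      refine Integrable.of_bound (C := M) (by fun_prop) ?_
      filter_upwards [hae] with x hx
      rw [Real.norm_of_nonneg (le_min (hV0 x hx) hM)]
      exact min_le_right _ _
    have i2 : Integrable (fun x => if V x ≤ M then V x else 0) μ := by
      refine Integrable.of_bound (C := M) hmeas.aestronglyMeasurable ?_
      filter_upwards [hae] with x hx
      split_ifs with h
      · rwa [Real.norm_of_nonneg (hV0 x hx)]
      · simpa using hM
    obtain ⟨i3, e3⟩ := inv_UL hf hp hinv i1
    have hle : ∫ x, ((1 - l) * (if V x ≤ M then V x else 0) - C) ∂μ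
        ≤ ∫ x, (min (V x) M - UL f p (fun x => min (V x) M) x) ∂μ := by
      refine integral_mono_ae ((i2.const_mul _).sub (integrable_const _)) (i1.sub i3) ?_
      filter_upwards [hae] with x hx
      have u1 : UL f p (fun x => min (V x) M) x ≤ UL f p V x := by
        rw [UL_apply, UL_apply]
        exact Finset.sum_le_sum fun i _ => mul_le_mul_of_nonneg_left (min_le_left _ _) (hp i).le
      have u2 : UL f p (fun x => min (V x) M) x ≤ M := by
        rw [UL_apply]
        calc _ ≤ ∑ i, p i * (M:ℝ) :=
              Finset.sum_le_sum fun i _ => mul_le_mul_of_nonneg_left (min_le_right _ _) (hp i).le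
          _ = M := by rw [← Finset.sum_mul, hs, one_mul]
      have u3 := hdr x hx
      split_ifs with h
      · rw [min_eq_left h]; linarith
      · rw [min_eq_right (not_le.1 h).le]; linarith
    rw [integral_sub i1 i3, e3, sub_self, integral_sub (i2.const_mul _) (integrable_const _),
      integral_const_mul] at hle
    simp only [integral_const, probReal_univ, smul_eq_mul, one_mul] at hle
    rw [← ofReal_integral_eq_lintegral_ofReal i2]
    · refine ENNReal.ofReal_le_ofReal ?_
      rw [le_div_iff₀ hl]; linarith
    · filter_upwards [hae] with x hx
      simp only [Pi.zero_apply]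
      split_ifs
      · exact hV0 x hx
      · exact le_rfl
  refine ⟨hVm.aestronglyMeasurable, ?_⟩
  rw [hasFiniteIntegral_iff_ofReal (by filter_upwards [hae] with x hx using hV0 x hx)]
  refine lt_of_le_of_lt (b := ENNReal.ofReal (C / (1 - l))) ?_ ENNReal.ofReal_lt_top
  have ht : Tendsto (fun M : ℕ => ∫⁻ x, ENNReal.ofReal (if V x ≤ M then V x else 0) ∂μ) atTop
      (nhds (∫⁻ x, ENNReal.ofReal (V x) ∂μ)) := by
    refine lintegral_tendsto_of_tendsto_of_monotone ?_ ?_ ?_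
    · intro M
      exact (ENNReal.measurable_ofReal.comp
        (Measurable.ite (measurableSet_le hVm measurable_const) hVm measurable_const)).aemeasurable
    · filter_upwards [hae] with x hx
      intro a b hab
      have hab' : (a:ℝ) ≤ b := by exact_mod_cast hab
      refine ENNReal.ofReal_le_ofReal ?_
      have := hV0 x hx
      split_ifs <;> first | linarith | skip
    · refine Filter.Eventually.of_forall fun x => ?_
      refine tendsto_const_nhds.congr' ?_
      filter_upwards [eventually_ge_atTop ⌈V x⌉₊] with M hM
      rw [if_pos ((Nat.le_ceil _).trans (by exact_mod_cast hM))]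
  exact le_of_tendsto' ht key

lemma poisson {N : ℕ} {f : Fin N → ℝ → ℝ} {p d e : Fin N → ℝ} (H : AdmissibleIFS N f p d e)
    {μ : Measure ℝ} [IsProbabilityMeasure μ]
    (hinv : (∑ i, ENNReal.ofReal (p i) • Measure.map (f i) μ) = μ)
    (hae : ∀ᵐ x ∂μ, x ∈ Ioo (0:ℝ) 1) (φ : ℝ → ℝ) (L : ℝ) (hL : 0 ≤ L) (hφm : Measurable φ)
    (hφ : ∀ a ∈ Icc (0:ℝ) 1, ∀ b ∈ Icc (0:ℝ) 1, |φ a - φ b| ≤ L * |a - b|)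
    (hφ0 : ∫ x, φ x ∂μ = 0) :
    ∃ g : ℝ → ℝ, Measurable g ∧ Integrable (fun x => |g x| ^ 3) μ ∧
      ∀ x ∈ Ioo (0:ℝ) 1, g x - UL f p g x = φ x := by
  have hI := adm_maps H
  have hm := adm_mono H
  have hp := H.ppos
  obtain ⟨V, hVm, hV0, ⟨l, C, hl0, hl1, hC, hdr⟩, r, A, hr0, hr1, hA, hcon⟩ := contraction H hI hm
  have hVi := V_integrable H.meas hp H.psum hI hinv hae hVm hV0 hl0 hl1 hC hdr
  set φn : ℕ → ℝ → ℝ := fun n => (UL f p ^ n) φ with hφn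
  have hφnm : ∀ n, Measurable (φn n) := fun n => UL_pow_measurable H.meas hφm n
  -- Lipschitz comparison
  have lip : ∀ n, ∀ x ∈ Ioo (0:ℝ) 1, ∀ y ∈ Ioo (0:ℝ) 1, x ≤ y →
      |φn n x - φn n y| ≤ L * ((UL f p ^ n) id y - (UL f p ^ n) id x) := by
    intro n x hx y hy hxy
    have m1 : MonotoneOn ((UL f p ^ n) (L • id - φ)) (Ioo 0 1) := by
      refine UL_pow_monoOn hp hI hm ?_ n
      intro a ha b hb hab
      have := (abs_le.1 (hφ a (Ioo_subset_Icc_self ha) b (Ioo_subset_Icc_self hb))).1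
      rw [abs_of_nonpos (by linarith)] at this
      simp only [Pi.sub_apply, Pi.smul_apply, id, smul_eq_mul]
      linarith
    have m2 : MonotoneOn ((UL f p ^ n) (L • id + φ)) (Ioo 0 1) := by
      refine UL_pow_monoOn hp hI hm ?_ n
      intro a ha b hb hab
      have := (abs_le.1 (hφ a (Ioo_subset_Icc_self ha) b (Ioo_subset_Icc_self hb))).2
      rw [abs_of_nonpos (by linarith)] at this
      simp only [Pi.add_apply, Pi.smul_apply, id, smul_eq_mul]
      linarith
    have q1 := m1 hx hy hxy
    have q2 := m2 hx hy hxy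
    simp only [map_sub, map_add, map_smul, Pi.sub_apply, Pi.add_apply, Pi.smul_apply, smul_eq_mul] at q1 q2
    rw [abs_le]
    constructor <;> simp only [hφn] <;> linarith
  have lip2 : ∀ n, ∀ x ∈ Ioo (0:ℝ) 1, ∀ y ∈ Ioo (0:ℝ) 1,
      |φn n x - φn n y| ≤ L * (A * r ^ n * (1 + V x + V y)) := by
    intro n x hx y hy
    rcases le_total x y with hxy | hxy
    · exact (lip n x hx y hy hxy).trans (mul_le_mul_of_nonneg_left (hcon n x hx y hy) hL)
    · rw [abs_sub_comm, add_right_comm]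
      exact (lip n y hy x hx hxy).trans (mul_le_mul_of_nonneg_left (hcon n y hy x hx) hL)
  -- boundedness
  set K := |φ 0| + L with hK
  have hK0 : 0 ≤ K := by positivity
  have hφb : ∀ x ∈ Ioo (0:ℝ) 1, |φ x| ≤ K := by
    intro x hx
    have := hφ x (Ioo_subset_Icc_self hx) 0 (left_mem_Icc.2 zero_le_one)
    rw [sub_zero, abs_of_pos hx.1] at this
    have h2 : L * x ≤ L := by nlinarith [hx.2]
    have h3 : |φ x| ≤ |φ x - φ 0| + |φ 0| := by
      have := abs_add_le (φ x - φ 0) (φ 0)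
      simpa using this
    linarith
  have hbd : ∀ n, ∀ x ∈ Ioo (0:ℝ) 1, |φn n x| ≤ K := by
    intro n x hx
    have a1 := UL_pow_mono hp hI (h := φ) (k := fun _ => K) (fun x hx => (abs_le.1 (hφb x hx)).2) n x hx
    have a2 := UL_pow_mono hp hI (h := fun _ => -K) (k := φ) (fun x hx => (abs_le.1 (hφb x hx)).1) n x hx
    rw [UL_pow_const H.psum] at a1 a2
    exact abs_le.2 ⟨a2, a1⟩
  have hφni : ∀ n, Integrable (φn n) μ := fun n =>
    Integrable.of_bound (C := K) (hφnm n).aestronglyMeasurable (by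
      filter_upwards [hae] with x hx using hbd n x hx)
  have hφnz : ∀ n, ∫ x, φn n x ∂μ = 0 := by
    intro n
    induction n with
    | zero => simpa [hφn] using hφ0
    | succ n ih =>
      have : φn (n+1) = UL f p (φn n) := by simp only [hφn]; rw [pow_succ', Module.End.mul_apply]
      rw [this, (inv_UL H.meas hp hinv (hφni n)).2, ih]
  set c := ∫ x, V x ∂μ with hc
  have hc0 : 0 ≤ c := integral_nonneg_of_ae (by filter_upwards [hae] with x hx using hV0 x hx)
  set B := L * A * (1 + c) with hB
  have hB0 : 0 ≤ B := by positivity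
  have dec : ∀ n, ∀ x ∈ Ioo (0:ℝ) 1, |φn n x| ≤ B * r ^ n * (1 + V x) := by
    intro n x hx
    have e1 : φn n x = ∫ y, (φn n x - φn n y) ∂μ := by
      rw [integral_sub (integrable_const _) (hφni n), hφnz n]; simp
    have e2 : |φn n x| ≤ ∫ y, L * (A * r ^ n * (1 + V x + V y)) ∂μ := by
      rw [e1]
      refine norm_integral_le_of_norm_le (f := fun y => φn n x - φn n y) ?_ ?_
      · exact (((integrable_const _).add hVi).const_mul _).const_mul _
      · filter_upwards [hae] with y hy
        exact lip2 n x hx y hy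
    rw [integral_const_mul, integral_const_mul, integral_add (integrable_const _) hVi] at e2
    simp only [integral_const, probReal_univ, smul_eq_mul, one_mul] at e2
    refine e2.trans ?_
    have : 1 + V x + c ≤ (1 + c) * (1 + V x) := by nlinarith [hV0 x hx]
    calc L * (A * r ^ n * (1 + V x + c)) ≤ L * (A * r ^ n * ((1 + c) * (1 + V x))) := by gcongr
      _ = _ := by rw [hB]; ring
  set s := r ^ ((3:ℕ):ℝ)⁻¹ with hs
  have hs0 : 0 < s := Real.rpow_pos_of_pos hr0 _
  have hs1 : s < 1 := Real.rpow_lt_one hr0.le hr1 (by positivity)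
  have hs3 : s ^ 3 = r := Real.rpow_inv_natCast_pow hr0.le (by norm_num)
  set T : ℝ → ℝ := fun x => (K ^ 2 * B * (1 + V x)) ^ ((3:ℕ):ℝ)⁻¹ with hT
  have hT0 : ∀ x ∈ Ioo (0:ℝ) 1, 0 ≤ T x := fun x hx =>
    Real.rpow_nonneg (mul_nonneg (by positivity) (by linarith [hV0 x hx])) _
  have hT3 : ∀ x ∈ Ioo (0:ℝ) 1, T x ^ 3 = K ^ 2 * B * (1 + V x) := fun x hx =>
    Real.rpow_inv_natCast_pow (mul_nonneg (by positivity) (by linarith [hV0 x hx])) (by norm_num)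
  have dec3 : ∀ n, ∀ x ∈ Ioo (0:ℝ) 1, |φn n x| ≤ T x * s ^ n := by
    intro n x hx
    rw [← pow_le_pow_iff_left₀ (abs_nonneg _) (mul_nonneg (hT0 x hx) (pow_nonneg hs0.le n)) (show 3 ≠ 0 by norm_num),
      mul_pow, hT3 x hx, ← pow_mul, mul_comm n 3, pow_mul, hs3]
    have h1 : |φn n x| ^ 2 ≤ K ^ 2 := pow_le_pow_left₀ (abs_nonneg _) (hbd n x hx) 2
    calc |φn n x| ^ 3 = |φn n x| ^ 2 * |φn n x| := by ring
      _ ≤ K ^ 2 * (B * r ^ n * (1 + V x)) :=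
          mul_le_mul h1 (dec n x hx) (abs_nonneg _) (by positivity)
      _ = _ := by ring
  have hsumm : ∀ x ∈ Ioo (0:ℝ) 1, Summable fun n => φn n x := by
    intro x hx
    refine Summable.of_norm_bounded ((summable_geometric_of_lt_one hs0.le hs1).mul_left (T x)) ?_
    intro n
    exact dec3 n x hx
  set g : ℝ → ℝ := fun x => ∑' n, (Ioo (0:ℝ) 1).indicator (φn n) x with hg
  have hgI : ∀ x ∈ Ioo (0:ℝ) 1, g x = ∑' n, φn n x := by
    intro x hx
    simp only [hg, Set.indicator_of_mem hx]
  have hgs : ∀ x ∈ Ioo (0:ℝ) 1, HasSum (fun n => φn n x) (g x) := by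
    intro x hx
    rw [hgI x hx]; exact (hsumm x hx).hasSum
  have hgm : Measurable g := by
    refine measurable_of_tendsto_metrizable (f := fun n x => ∑ k ∈ Finset.range n, (Ioo (0:ℝ) 1).indicator (φn k) x) ?_ ?_
    · intro n
      exact Finset.measurable_fun_sum _ fun k _ => (hφnm k).indicator measurableSet_Ioo
    · rw [tendsto_pi_nhds]
      intro x
      refine (Summable.hasSum ?_).tendsto_sum_nat
      by_cases hx : x ∈ Ioo (0:ℝ) 1
      · simpa only [Set.indicator_of_mem hx] using hsumm x hx
      · simpa only [Set.indicator_of_notMem hx] using summable_zero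
  have hgb : ∀ x ∈ Ioo (0:ℝ) 1, |g x| ≤ T x * (1 - s)⁻¹ := by
    intro x hx
    rw [hgI x hx, ← Real.norm_eq_abs]
    exact tsum_of_norm_bounded (f := fun n => φn n x) ((hasSum_geometric_of_lt_one hs0.le hs1).mul_left (T x)) (fun n => dec3 n x hx)
  refine ⟨g, hgm, ?_, ?_⟩
  · refine Integrable.mono' (g := fun x => K ^ 2 * B * (1 + V x) * ((1 - s)⁻¹) ^ 3) ?_ (by fun_prop) ?_
    · exact (((integrable_const _).add hVi).const_mul _).mul_const _
    · filter_upwards [hae] with x hx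
      rw [← hT3 x hx, ← mul_pow, Real.norm_of_nonneg (by positivity)]
      exact pow_le_pow_left₀ (abs_nonneg _) (hgb x hx) 3
  · intro x hx
    have h1 : HasSum (fun n => φn (n+1) x) (UL f p g x) := by
      have := hasSum_sum (s := Finset.univ) (f := fun i n => p i * φn n (f i x)) (a := fun i => p i * g (f i x))
        (fun i _ => (hgs _ (hI i hx)).mul_left (p i))
      rw [UL_apply]
      convert this using 1
      funext n
      simp only [hφn]
      rw [UL_pow_succ]
    have h2 := (hasSum_nat_add_iff' 1).2 (hgs x hx)
    have h3 := h1.unique h2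
    rw [h3]
    simp [hφn]

lemma markov_word {E : Type*} [NormedAddCommGroup E] [NormedSpace ℝ E] [CompleteSpace E]
    {N : ℕ} {p : Fin N → ℝ} (hp : ∀ i, 0 < p i) (hs : ∑ i, p i = 1)
    {ℙ : Measure (ℕ → Fin N)}
    (hcyl : ∀ m : ℕ, ℙ.map (fun ω (k : Fin m) => ω k)
      = Measure.pi (fun _ : Fin m => ∑ j, ENNReal.ofReal (p j) • Measure.dirac j))
    (k : ℕ) (G : (Fin k → Fin N) → Fin N → E) :
    ∫ ω, G (fun j => ω j) (ω k) ∂ℙ = ∫ ω, ∑ i, p i • G (fun j : Fin k => ω j) i ∂ℙ := by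
  set ν : Measure (Fin N) := ∑ j, ENNReal.ofReal (p j) • Measure.dirac j with hν
  have hνp : IsProbabilityMeasure ν := by
    constructor
    simp only [hν, Measure.coe_finsetSum, Finset.sum_apply, Measure.smul_apply, measure_univ,
      smul_eq_mul, mul_one]
    rw [← ENNReal.ofReal_sum_of_nonneg fun i _ => (hp i).le, hs, ENNReal.ofReal_one]
  have hr : ∀ m : ℕ, Measurable (fun (ω : ℕ → Fin N) (k : Fin m) => ω k) := fun m =>
    measurable_pi_lambda _ fun j => measurable_pi_apply _
  have e1 : ∫ ω, G (fun j => ω j) (ω k) ∂ℙ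
      = ∫ w : Fin (k+1) → Fin N, G (fun j => w j.castSucc) (w (Fin.last k)) ∂(Measure.pi fun _ => ν) := by
    rw [← hcyl (k+1), integral_map (hr _).aemeasurable]
    · simp
    · have := hνp
      rw [hcyl (k+1)]
      exact Integrable.of_finite.aestronglyMeasurable
  have e2 : ∫ ω, ∑ i, p i • G (fun j : Fin k => ω j) i ∂ℙ
      = ∫ w : Fin k → Fin N, ∑ i, p i • G w i ∂(Measure.pi fun _ => ν) := by
    rw [← hcyl k, integral_map (hr _).aemeasurable]
    rw [hcyl k]
    exact Integrable.of_finite.aestronglyMeasurable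
  have e3 : ∫ w : Fin (k+1) → Fin N, G (fun j => w j.castSucc) (w (Fin.last k)) ∂(Measure.pi fun _ => ν)
      = ∫ q : Fin N × (Fin k → Fin N), G q.2 q.1 ∂(ν.prod (Measure.pi fun _ => ν)) := by
    rw [← (measurePreserving_piFinSuccAbove (fun _ : Fin (k+1) => ν) (Fin.last k)).integral_comp
      (MeasurableEquiv.measurableEmbedding _)]
    simp [MeasurableEquiv.piFinSuccAbove, Fin.removeNth]
    rfl
  rw [e1, e3, e2, integral_prod_symm _ Integrable.of_finite]
  refine integral_congr_ae (Filter.Eventually.of_forall fun w => ?_)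
  simp only [hν]
  rw [integral_finsetSum_measure fun i _ => (Integrable.of_finite (μ := Measure.dirac i)).smul_measure (by simp)]
  refine Finset.sum_congr rfl fun i _ => ?_
  rw [integral_smul_measure, integral_dirac, ENNReal.toReal_ofReal (hp i).le]

lemma markov {E : Type*} [NormedAddCommGroup E] [NormedSpace ℝ E] [CompleteSpace E]
    {N : ℕ} {p : Fin N → ℝ} (hp : ∀ i, 0 < p i) (hs : ∑ i, p i = 1)
    {ℙ : Measure (ℕ → Fin N)} [IsProbabilityMeasure ℙ] {μ : Measure ℝ} [IsProbabilityMeasure μ]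
    (hcyl : ∀ m : ℕ, ℙ.map (fun ω (k : Fin m) => ω k)
      = Measure.pi (fun _ : Fin m => ∑ j, ENNReal.ofReal (p j) • Measure.dirac j))
    (k : ℕ) (B : Fin N → (ℕ → Fin N) × ℝ → E)
    (hdep : ∀ i ω ω' x, (∀ j < k, ω j = ω' j) → B i (ω, x) = B i (ω', x))
    (hint : ∀ i, Integrable (B i) (ℙ.prod μ)) :
    Integrable (fun z => B (z.1 k) z) (ℙ.prod μ) ∧
    ∫ z, B (z.1 k) z ∂(ℙ.prod μ) = ∫ z, ∑ i, p i • B i z ∂(ℙ.prod μ) := by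
  have hI : Integrable (fun z : (ℕ → Fin N) × ℝ => B (z.1 k) z) (ℙ.prod μ) := by
    have e : (fun z : (ℕ → Fin N) × ℝ => B (z.1 k) z)
        = fun z => ∑ i, ({z : (ℕ → Fin N) × ℝ | z.1 k = i}).indicator (B i) z := by
      funext z
      rw [Finset.sum_eq_single (z.1 k)]
      · simp
      · intro b _ hb
        rw [Set.indicator_of_notMem]
        exact fun h => hb h.symm
      · simp
    rw [e]
    refine integrable_finsetSum _ fun i _ => (hint i).indicator ?_
    have : Measurable fun z : (ℕ → Fin N) × ℝ => z.1 k := by fun_prop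
    exact this (measurableSet_singleton i)
  refine ⟨hI, ?_⟩
  have hI2 : Integrable (fun z : (ℕ → Fin N) × ℝ => ∑ i, p i • B i z) (ℙ.prod μ) :=
    integrable_finsetSum _ fun i _ => (hint i).smul (p i)
  rw [integral_prod_symm _ hI, integral_prod_symm _ hI2]
  refine integral_congr_ae (Filter.Eventually.of_forall fun x => ?_)
  simp only
  let ext : Fin N → (Fin k → Fin N) → ℕ → Fin N := fun i w j => if h : j < k then w ⟨j, h⟩ else i
  have hext : ∀ i ω, B i (ω, x) = B i (ext i (fun j : Fin k => ω j), x) := by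
    intro i ω
    refine hdep i _ _ x fun j hj => ?_
    simp [ext, hj]
  have := markov_word hp hs hcyl k (fun w i => B i (ext i w, x))
  simp only [← hext] at this
  exact this

noncomputable def chX {N : ℕ} (f : Fin N → ℝ → ℝ) (k : ℕ) (z : (ℕ → Fin N) × ℝ) : ℝ :=
  wordIter f z.1 k z.2

lemma chX_succ {N : ℕ} (f : Fin N → ℝ → ℝ) (k : ℕ) (z : (ℕ → Fin N) × ℝ) :
    chX f (k+1) z = f (z.1 k) (chX f k z) := rfl

lemma chX_measurable {N : ℕ} {f : Fin N → ℝ → ℝ} (hf : ∀ i, Measurable (f i)) (k : ℕ) :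
    Measurable (chX f k) := by
  induction k with
  | zero => exact measurable_snd
  | succ k ih =>
    have h1 : Measurable (fun q : Fin N × ℝ => f q.1 q.2) :=
      measurable_from_prod_countable_right fun i => hf i
    have h2 : Measurable fun z : (ℕ → Fin N) × ℝ => (z.1 k, chX f k z) :=
      (by fun_prop : Measurable fun z : (ℕ → Fin N) × ℝ => z.1 k).prodMk ih
    exact h1.comp h2

lemma chX_dep {N : ℕ} (f : Fin N → ℝ → ℝ) (k : ℕ) (ω ω' : ℕ → Fin N) (x : ℝ)
    (h : ∀ j < k, ω j = ω' j) : chX f k (ω, x) = chX f k (ω', x) := by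
  induction k with
  | zero => rfl
  | succ k ih =>
    rw [chX_succ, chX_succ, ih fun j hj => h j (by omega)]
    simp only
    rw [h k (by omega)]

lemma chX_law {N : ℕ} {f : Fin N → ℝ → ℝ} {p : Fin N → ℝ} (hf : ∀ i, Measurable (f i))
    (hp : ∀ i, 0 < p i) (hs : ∑ i, p i = 1)
    {ℙ : Measure (ℕ → Fin N)} [IsProbabilityMeasure ℙ] {μ : Measure ℝ} [IsProbabilityMeasure μ]
    (hinv : (∑ i, ENNReal.ofReal (p i) • Measure.map (f i) μ) = μ)
    (hcyl : ∀ m : ℕ, ℙ.map (fun ω (k : Fin m) => ω k)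
      = Measure.pi (fun _ : Fin m => ∑ j, ENNReal.ofReal (p j) • Measure.dirac j))
    (k : ℕ) : MeasurePreserving (chX f k) (ℙ.prod μ) μ := by
  induction k with
  | zero => exact measurePreserving_snd
  | succ k ih =>
    refine ⟨chX_measurable hf _, ?_⟩
    have : IsProbabilityMeasure ((ℙ.prod μ).map (chX f (k+1))) :=
      Measure.isProbabilityMeasure_map (chX_measurable hf _).aemeasurable
    refine Measure.ext fun s hs' => ?_
    rw [← measureReal_eq_measureReal_iff]
    set h : ℝ → ℝ := s.indicator (fun _ => 1) with hh
    have hhm : Measurable h := measurable_const.indicator hs'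
    have hhb : ∀ x, ‖h x‖ ≤ 1 := fun x => by
      simp only [hh]; by_cases hx : x ∈ s <;> simp [hx]
    have hhi : Integrable h μ := Integrable.of_bound (C := 1) hhm.aestronglyMeasurable (Filter.Eventually.of_forall hhb)
    have a1 : ((ℙ.prod μ).map (chX f (k+1))).real s = ∫ z, h (chX f (k+1) z) ∂(ℙ.prod μ) := by
      rw [← integral_map (chX_measurable hf _).aemeasurable hhm.aestronglyMeasurable, hh,
        integral_indicator_const _ hs']
      simp
    have a2 : μ.real s = ∫ x, h x ∂μ := by
      rw [hh, integral_indicator_const _ hs']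
      simp
    have a3 := (markov hp hs hcyl (μ := μ) k (fun i z => h (f i (chX f k z)))
      (fun i ω ω' x hd => by rw [chX_dep f k ω ω' x hd])
      (fun i => Integrable.of_bound (C := 1)
        (hhm.comp ((hf i).comp (chX_measurable hf k))).aestronglyMeasurable
        (Filter.Eventually.of_forall fun z => hhb _))).2
    rw [a1, a2]
    simp only [chX_succ]
    rw [a3, ← (inv_UL hf hp hinv hhi).2]
    conv_rhs => rw [← ih.map_eq]
    rw [integral_map ih.measurable.aemeasurable (UL_measurable hf hhm).aestronglyMeasurable]
    simp only [UL_apply, smul_eq_mul]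

lemma exp_bound3 (x : ℝ) :
    ‖Complex.exp (Complex.I * x) - (1 + Complex.I * x - (x:ℂ) ^ 2 / 2)‖ ≤ 4 * |x| ^ 3 := by
  rcases le_total |x| 1 with h | h
  · have hx : ‖Complex.I * (x:ℂ)‖ ≤ 1 := by simpa using h
    have := Complex.exp_bound hx (n := 3) (by norm_num)
    have e : ∑ m ∈ Finset.range 3, (Complex.I * (x:ℂ)) ^ m / (m.factorial : ℂ)
        = 1 + Complex.I * x - (x:ℂ) ^ 2 / 2 := by
      simp [Finset.sum_range_succ, mul_pow, Nat.factorial]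
      ring
    rw [e] at this
    refine this.trans ?_
    have e2 : ‖Complex.I * (x:ℂ)‖ = |x| := by simp
    rw [e2]
    norm_num [Nat.factorial]
    nlinarith [pow_nonneg (abs_nonneg x) 3]
  · have h1 : ‖Complex.exp (Complex.I * x)‖ = 1 := by rw [mul_comm]; exact Complex.norm_exp_ofReal_mul_I x
    have h2 : ‖(1 + Complex.I * x - (x:ℂ) ^ 2 / 2)‖ ≤ 1 + |x| + |x| ^ 2 / 2 := by
      refine (norm_sub_le _ _).trans (add_le_add ((norm_add_le _ _).trans ?_) ?_)
      · simp
      · simp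
    refine (norm_sub_le _ _).trans ?_
    have h3 : |x| ≤ |x| ^ 3 := by
      nlinarith [mul_nonneg (abs_nonneg x) (abs_nonneg x)]
    have h4 : |x| ^ 2 ≤ |x| ^ 3 := by nlinarith [mul_nonneg (abs_nonneg x) (abs_nonneg x)]
    linarith

lemma one_step {N : ℕ} {p : Fin N → ℝ} (hp : ∀ i, 0 < p i) (hs : ∑ i, p i = 1) (D : Fin N → ℝ)
    (hD : ∑ i, p i * D i = 0) (u : ℝ) :
    ‖∑ i, p i • Complex.exp (Complex.I * ((u * D i : ℝ) : ℂ))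
      - ((1 - u ^ 2 / 2 * ∑ i, p i * D i ^ 2 : ℝ) : ℂ)‖ ≤ 4 * |u| ^ 3 * ∑ i, p i * |D i| ^ 3 := by
  have e : ((1 - u ^ 2 / 2 * ∑ i, p i * D i ^ 2 : ℝ) : ℂ)
      = ∑ i, p i • (1 + Complex.I * ((u * D i : ℝ) : ℂ) - (((u * D i : ℝ) : ℂ)) ^ 2 / 2) := by
    have h1 : ∑ i, p i • (1 + Complex.I * ((u * D i : ℝ) : ℂ) - (((u * D i : ℝ) : ℂ)) ^ 2 / 2)
      = ((∑ i, p i : ℝ) : ℂ) + Complex.I * u * ((∑ i, p i * D i : ℝ) : ℂ)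
        - u ^ 2 / 2 * ((∑ i, p i * D i ^ 2 : ℝ) : ℂ) := by
      push_cast
      rw [Finset.mul_sum, Finset.mul_sum, ← Finset.sum_add_distrib, ← Finset.sum_sub_distrib]
      refine Finset.sum_congr rfl fun i _ => ?_
      rw [Complex.real_smul]
      ring
    rw [h1, hs, hD]
    push_cast
    ring
  rw [e, ← Finset.sum_sub_distrib, Finset.mul_sum]
  refine norm_sum_le_of_le _ fun i _ => ?_
  rw [← smul_sub, norm_smul, Real.norm_of_nonneg (hp i).le]
  calc _ ≤ p i * (4 * |u * D i| ^ 3) := mul_le_mul_of_nonneg_left (exp_bound3 _) (hp i).le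
    _ = _ := by rw [abs_mul, mul_pow]; ring

lemma rec_bound (a : ℕ → ℂ) (c : ℂ) (hc : ‖c‖ ≤ 1) (δ : ℝ) (h : ∀ k, ‖a (k+1) - c * a k‖ ≤ δ)
    (n : ℕ) : ‖a n - c ^ n * a 0‖ ≤ n * δ := by
  induction n with
  | zero => simp
  | succ n ih =>
    have e : a (n+1) - c ^ (n+1) * a 0 = (a (n+1) - c * a n) + c * (a n - c ^ n * a 0) := by ring
    rw [e]
    refine (norm_add_le _ _).trans ?_
    rw [norm_mul]
    have : ‖c‖ * ‖a n - c ^ n * a 0‖ ≤ 1 * (n * δ) := mul_le_mul hc ih (norm_nonneg _) zero_le_one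
    push_cast
    linarith [h n]

lemma clt_abstract (a : ℝ → ℕ → ℂ) (s2 : ℝ) (hs : 0 ≤ s2) (ha0 : ∀ u, a u 0 = 1)
    (ha : ∀ ε > 0, ∃ K : ℝ, 0 ≤ K ∧ ∀ u : ℝ, ∃ b : ℕ → ℂ, (∀ k, ‖b k‖ ≤ K * u ^ 2) ∧
      ∀ k, ‖(a u (k+1) - b (k+1)) - ((1 - u ^ 2 * s2 / 2 : ℝ) : ℂ) * (a u k - b k)‖
        ≤ u ^ 2 * ε + K * |u| ^ 3 + K * u ^ 4) (t : ℝ) :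
    Tendsto (fun n : ℕ => a (t / Real.sqrt n) n) atTop (nhds (Complex.exp (-(s2 * t ^ 2 / 2)))) := by
  have hu : Tendsto (fun n : ℕ => t / Real.sqrt n) atTop (nhds 0) :=
    Tendsto.const_div_atTop (Real.tendsto_sqrt_atTop.comp tendsto_natCast_atTop_atTop) t
  have hlim : Tendsto (fun n : ℕ => ((1 - (t / Real.sqrt n) ^ 2 * s2 / 2 : ℝ) : ℂ) ^ n) atTop
      (nhds (Complex.exp (-(s2 * t ^ 2 / 2)))) := by
    have := Complex.tendsto_one_add_div_pow_exp (-(s2 * t ^ 2 / 2) : ℂ)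
    refine this.congr' ?_
    filter_upwards [eventually_gt_atTop 0] with n hn
    congr 1
    have hn' : (0:ℝ) < n := by exact_mod_cast hn
    have e : (t / Real.sqrt n) ^ 2 = t ^ 2 / n := by rw [div_pow, Real.sq_sqrt hn'.le]
    rw [e]
    push_cast
    ring
  suffices hz : Tendsto (fun n : ℕ => a (t / Real.sqrt n) n
      - ((1 - (t / Real.sqrt n) ^ 2 * s2 / 2 : ℝ) : ℂ) ^ n) atTop (nhds 0) by
    simpa using hz.add hlim
  rw [Metric.tendsto_nhds]
  intro η hη
  obtain ⟨K, hK, hb⟩ := ha (η / (2 * (t ^ 2 + 1))) (by positivity)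
  set ε := η / (2 * (t ^ 2 + 1)) with hε
  have hlim2 : Tendsto (fun n : ℕ => t ^ 2 * ε + K * t ^ 2 * |t / Real.sqrt n| + K * t ^ 2 * (t / Real.sqrt n) ^ 2
      + 2 * K * (t / Real.sqrt n) ^ 2) atTop (nhds (t ^ 2 * ε + K * t ^ 2 * |(0:ℝ)| + K * t ^ 2 * 0 ^ 2 + 2 * K * 0 ^ 2)) :=
    ((tendsto_const_nhds.add (hu.abs.const_mul _)).add ((hu.pow 2).const_mul _)).add ((hu.pow 2).const_mul _)
  have hlt : t ^ 2 * ε + K * t ^ 2 * |(0:ℝ)| + K * t ^ 2 * 0 ^ 2 + 2 * K * 0 ^ 2 < η := by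
    simp only [abs_zero, mul_zero, ne_eq, OfNat.ofNat_ne_zero, not_false_eq_true, zero_pow, add_zero]
    rw [hε, mul_div_assoc', div_lt_iff₀ (by positivity)]
    nlinarith [sq_nonneg t]
  have hq : Tendsto (fun n : ℕ => (t / Real.sqrt n) ^ 2 * s2 / 2) atTop (nhds (0 ^ 2 * s2 / 2)) :=
    ((hu.pow 2).mul_const _).div_const _
  have hq1 := hq.eventually (gt_mem_nhds (show (0:ℝ) ^ 2 * s2 / 2 < 1 by norm_num))
  filter_upwards [hlim2.eventually (gt_mem_nhds hlt), hq1, eventually_gt_atTop 0] with n h1 h2 hn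
  have hn' : (0:ℝ) < n := by exact_mod_cast hn
  have hnu : (n:ℝ) * (t / Real.sqrt n) ^ 2 = t ^ 2 := by
    rw [div_pow, Real.sq_sqrt hn'.le]; field_simp
  set u := t / Real.sqrt n with hudef
  obtain ⟨b, hb1, hb2⟩ := hb u
  set c : ℂ := ((1 - u ^ 2 * s2 / 2 : ℝ) : ℂ) with hc
  have hc1 : ‖c‖ ≤ 1 := by
    rw [hc, Complex.norm_real, Real.norm_eq_abs, abs_le]
    have : 0 ≤ u ^ 2 * s2 / 2 := by positivity
    constructor <;> linarith
  have hr := rec_bound (fun k => a u k - b k) c hc1 _ hb2 n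
  simp only [ha0] at hr
  rw [dist_zero_right]
  have e : a u n - c ^ n = (a u n - b n - c ^ n * (1 - b 0)) + b n - c ^ n * b 0 := by ring
  rw [e]
  refine lt_of_le_of_lt ?_ h1
  have h3 : ‖c ^ n * b 0‖ ≤ K * u ^ 2 := by
    rw [norm_mul, norm_pow]
    calc _ ≤ 1 * ‖b 0‖ := mul_le_mul_of_nonneg_right (pow_le_one₀ (norm_nonneg _) hc1) (norm_nonneg _)
      _ ≤ _ := by rw [one_mul]; exact hb1 0
  have h4 : (n:ℝ) * (u ^ 2 * ε + K * |u| ^ 3 + K * u ^ 4) = t ^ 2 * ε + K * t ^ 2 * |u| + K * t ^ 2 * u ^ 2 := by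
    have e3 : |u| ^ 3 = u ^ 2 * |u| := by rw [pow_succ, sq_abs]
    rw [e3, ← hnu]; ring
  rw [h4] at hr
  calc _ ≤ ‖a u n - b n - c ^ n * (1 - b 0)‖ + ‖b n‖ + ‖c ^ n * b 0‖ :=
        (norm_sub_le _ _).trans (add_le_add (norm_add_le _ _) le_rfl)
    _ ≤ _ := by linarith [hb1 n]

lemma approx_lip {μ : Measure ℝ} [IsProbabilityMeasure μ] (hae : ∀ᵐ x ∂μ, x ∈ Ioo (0:ℝ) 1)
    (v : ℝ → ℝ) (hv : Integrable v μ) (ε : ℝ) (hε : 0 < ε) :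
    ∃ (ψ : ℝ → ℝ) (L : ℝ), 0 ≤ L ∧ Measurable ψ ∧
      (∀ a ∈ Icc (0:ℝ) 1, ∀ b ∈ Icc (0:ℝ) 1, |ψ a - ψ b| ≤ L * |a - b|) ∧ Integrable ψ μ ∧
      ∫ x, ψ x ∂μ = 0 ∧ ∫ x, |v x - (∫ y, v y ∂μ) - ψ x| ∂μ ≤ ε := by
  obtain ⟨g, -, hg, hgc, hgi⟩ := hv.exists_hasCompactSupport_integral_sub_le (show 0 < ε/4 by positivity)
  obtain ⟨P, hP⟩ := exists_polynomial_near_of_continuousOn 0 1 g hgc.continuousOn (ε/4) (by positivity)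
  have hPc : Continuous fun x => P.eval x := P.continuous
  have hPlip : ∃ L : ℝ, 0 ≤ L ∧ ∀ a ∈ Icc (0:ℝ) 1, ∀ b ∈ Icc (0:ℝ) 1, |P.eval a - P.eval b| ≤ L * |a - b| := by
    obtain ⟨L, hL⟩ := isCompact_Icc.exists_bound_of_continuousOn (s := Icc (0:ℝ) 1)
      (f := fun x => P.derivative.eval x) P.derivative.continuous.continuousOn
    refine ⟨L, (norm_nonneg _).trans (hL 0 (left_mem_Icc.2 zero_le_one)), fun a ha b hb => ?_⟩
    exact (convex_Icc (0:ℝ) 1).norm_image_sub_le_of_norm_hasDerivWithin_le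
      (fun x _ => (P.hasDerivAt x).hasDerivWithinAt) hL hb ha
  obtain ⟨L, hL, hlip⟩ := hPlip
  have hPi : Integrable (fun x => P.eval x) μ := by
    obtain ⟨B, hB⟩ := isCompact_Icc.exists_bound_of_continuousOn (s := Icc (0:ℝ) 1)
      (f := fun x => P.eval x) hPc.continuousOn
    refine Integrable.of_bound (C := B) hPc.aestronglyMeasurable ?_
    filter_upwards [hae] with x hx using hB x (Ioo_subset_Icc_self hx)
  have h1 : ∫ x, |v x - P.eval x| ∂μ ≤ ε / 2 := by
    have : ∫ x, |v x - P.eval x| ∂μ ≤ ∫ x, (‖v x - g x‖ + ε / 4) ∂μ := by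
      refine integral_mono_ae (hv.sub hPi).abs ((hv.sub hgi).norm.add (integrable_const _)) ?_
      filter_upwards [hae] with x hx
      have a1 := hP x (Ioo_subset_Icc_self hx)
      rw [abs_sub_comm] at a1
      have := abs_sub_le (v x) (g x) (P.eval x)
      simp only [Real.norm_eq_abs]
      linarith
    have i1 : Integrable (fun x => ‖v x - g x‖) μ := (hv.sub hgi).norm
    rw [integral_add i1 (integrable_const _)] at this
    simp only [integral_const, probReal_univ, smul_eq_mul, one_mul] at this
    linarith
  set m := ∫ x, P.eval x ∂μ with hm
  have h2 : |(∫ y, v y ∂μ) - m| ≤ ε / 2 := by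
    rw [hm, ← integral_sub hv hPi]
    exact (abs_integral_le_integral_abs).trans h1
  refine ⟨fun x => P.eval x - m, L, hL, by fun_prop, ?_, hPi.sub (integrable_const _), ?_, ?_⟩
  · intro a ha b hb
    simpa using hlip a ha b hb
  · rw [integral_sub hPi (integrable_const _)]; simp [hm]
  · have : ∫ x, |v x - (∫ y, v y ∂μ) - (P.eval x - m)| ∂μ ≤ ∫ x, (|v x - P.eval x| + ε / 2) ∂μ := by
      refine integral_mono ((hv.sub (integrable_const _)).sub (hPi.sub (integrable_const _))).abs
        ((hv.sub hPi).abs.add (integrable_const _)) ?_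
      intro x
      have e : v x - (∫ y, v y ∂μ) - (P.eval x - m) = (v x - P.eval x) - ((∫ y, v y ∂μ) - m) := by ring
      simp only [e]
      have := abs_sub (v x - P.eval x) ((∫ y, v y ∂μ) - m)
      linarith
    refine this.trans ?_
    have i2 : Integrable (fun x => |v x - P.eval x|) μ := (hv.sub hPi).abs
    rw [integral_add i2 (integrable_const _)]
    simp only [integral_const, probReal_univ, smul_eq_mul, one_mul]
    linarith


lemma memLp3 {Ω : Type*} [MeasurableSpace Ω] {μ : Measure Ω} {h : Ω → ℝ} (hm : Measurable h)
    (hi : Integrable (fun x => |h x| ^ 3) μ) : MemLp h 3 μ := by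
  rw [← integrable_norm_rpow_iff hm.aestronglyMeasurable (by norm_num) (by norm_num)]
  refine hi.congr (Filter.Eventually.of_forall fun x => ?_)
  simp only [Real.norm_eq_abs, ENNReal.toReal_ofNat]
  norm_cast

lemma memLp3_int {Ω : Type*} [MeasurableSpace Ω] {μ : Measure Ω} {h : Ω → ℝ}
    (hi : MemLp h 3 μ) : Integrable (fun x => |h x| ^ 3) μ := by
  have := hi.integrable_norm_rpow (by norm_num) (by norm_num)
  refine this.congr (Filter.Eventually.of_forall fun x => ?_)
  simp only [Real.norm_eq_abs, ENNReal.toReal_ofNat]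
  norm_cast

lemma memLp3_2 {Ω : Type*} [MeasurableSpace Ω] {μ : Measure Ω} [IsProbabilityMeasure μ] {h : Ω → ℝ}
    (hi : MemLp h 3 μ) : MemLp h 2 μ := hi.mono_exponent (by norm_num)

noncomputable def dg {N : ℕ} (f : Fin N → ℝ → ℝ) (p : Fin N → ℝ) (g : ℝ → ℝ) (i : Fin N) (x : ℝ) : ℝ :=
  g (f i x) - UL f p g x

noncomputable def mM {N : ℕ} (f : Fin N → ℝ → ℝ) (p : Fin N → ℝ) (g : ℝ → ℝ) (k : ℕ)
    (z : (ℕ → Fin N) × ℝ) : ℝ :=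
  ∑ j ∈ range k, dg f p g (z.1 j) (chX f j z)

noncomputable def vv {N : ℕ} (f : Fin N → ℝ → ℝ) (p : Fin N → ℝ) (g : ℝ → ℝ) (x : ℝ) : ℝ :=
  ∑ i, p i * dg f p g i x ^ 2

section dgs
variable {N : ℕ} {f : Fin N → ℝ → ℝ} {p : Fin N → ℝ} {g : ℝ → ℝ}

lemma dg_sum (hs : ∑ i, p i = 1) (x : ℝ) : ∑ i, p i * dg f p g i x = 0 := by
  simp only [dg, mul_sub, Finset.sum_sub_distrib, ← Finset.sum_mul, hs, one_mul]
  simp [UL_apply]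

lemma dg_meas (hf : ∀ i, Measurable (f i)) (hg : Measurable g) (i : Fin N) :
    Measurable (dg f p g i) := (hg.comp (hf i)).sub (UL_measurable hf hg)

lemma vv_meas (hf : ∀ i, Measurable (f i)) (hg : Measurable g) : Measurable (vv f p g) :=
  Finset.measurable_fun_sum _ fun i _ => ((dg_meas hf hg i).pow_const 2).const_mul _

lemma vv_nonneg (hp : ∀ i, 0 < p i) (x : ℝ) : 0 ≤ vv f p g x :=
  Finset.sum_nonneg fun i _ => mul_nonneg (hp i).le (sq_nonneg _)

lemma mM_succ (k : ℕ) (z : (ℕ → Fin N) × ℝ) :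
    mM f p g (k+1) z = mM f p g k z + dg f p g (z.1 k) (chX f k z) := by
  simp [mM, Finset.sum_range_succ]

lemma dgX_meas (hf : ∀ i, Measurable (f i)) (hg : Measurable g) (j : ℕ) :
    Measurable fun z : (ℕ → Fin N) × ℝ => dg f p g (z.1 j) (chX f j z) :=
  (hg.comp (chX_measurable hf (j+1))).sub ((UL_measurable hf hg).comp (chX_measurable hf j))

lemma mM_meas (hf : ∀ i, Measurable (f i)) (hg : Measurable g) (k : ℕ) : Measurable (mM f p g k) :=
  Finset.measurable_fun_sum _ fun j _ => dgX_meas hf hg j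

lemma mM_dep (k : ℕ) (ω ω' : ℕ → Fin N) (x : ℝ)
    (h : ∀ j < k, ω j = ω' j) : mM f p g k (ω, x) = mM f p g k (ω', x) := by
  refine Finset.sum_congr rfl fun j hj => ?_
  have hj := Finset.mem_range.1 hj
  rw [chX_dep f j ω ω' x fun i hi => h i (by omega)]
  simp only [h j hj]

variable {ℙ : Measure (ℕ → Fin N)} [IsProbabilityMeasure ℙ] {μ : Measure ℝ} [IsProbabilityMeasure μ]

lemma comp_memLp3 (hf : ∀ i, Measurable (f i)) (hp : ∀ i, 0 < p i)
    (hinv : (∑ i, ENNReal.ofReal (p i) • Measure.map (f i) μ) = μ)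
    (hg : Measurable g) (h3 : Integrable (fun x => |g x| ^ 3) μ) (i : Fin N) :
    MemLp (fun x => g (f i x)) 3 μ :=
  memLp3 (hg.comp (hf i)) (inv_integrable' hf hp hinv h3 i)

lemma UL_memLp3 (hf : ∀ i, Measurable (f i)) (hp : ∀ i, 0 < p i)
    (hinv : (∑ i, ENNReal.ofReal (p i) • Measure.map (f i) μ) = μ)
    (hg : Measurable g) (h3 : Integrable (fun x => |g x| ^ 3) μ) :
    MemLp (UL f p g) 3 μ := by
  have : MemLp (fun x => ∑ i, p i * g (f i x)) 3 μ :=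
    memLp_finsetSum _ fun i _ => (comp_memLp3 hf hp hinv hg h3 i).const_mul _
  exact this

lemma dg_memLp3 (hf : ∀ i, Measurable (f i)) (hp : ∀ i, 0 < p i)
    (hinv : (∑ i, ENNReal.ofReal (p i) • Measure.map (f i) μ) = μ)
    (hg : Measurable g) (h3 : Integrable (fun x => |g x| ^ 3) μ) (i : Fin N) :
    MemLp (dg f p g i) 3 μ :=
  (comp_memLp3 hf hp hinv hg h3 i).sub (UL_memLp3 hf hp hinv hg h3)

lemma vv_int (hf : ∀ i, Measurable (f i)) (hp : ∀ i, 0 < p i)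
    (hinv : (∑ i, ENNReal.ofReal (p i) • Measure.map (f i) μ) = μ)
    (hg : Measurable g) (h3 : Integrable (fun x => |g x| ^ 3) μ) :
    Integrable (vv f p g) μ :=
  integrable_finsetSum _ fun i _ => ((memLp3_2 (dg_memLp3 hf hp hinv hg h3 i)).integrable_sq).const_mul _

/-- integrals along the chain. -/
lemma chX_int (hf : ∀ i, Measurable (f i)) (hp : ∀ i, 0 < p i) (hs : ∑ i, p i = 1)
    (hinv : (∑ i, ENNReal.ofReal (p i) • Measure.map (f i) μ) = μ)
    (hcyl : ∀ m : ℕ, ℙ.map (fun ω (k : Fin m) => ω k)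
      = Measure.pi (fun _ : Fin m => ∑ j, ENNReal.ofReal (p j) • Measure.dirac j))
    (k : ℕ) {h : ℝ → ℝ} (hh : Integrable h μ) :
    Integrable (fun z => h (chX f k z)) (ℙ.prod μ) ∧
      ∫ z, h (chX f k z) ∂(ℙ.prod μ) = ∫ x, h x ∂μ := by
  have l := chX_law hf hp hs hinv hcyl k
  refine ⟨l.integrable_comp_of_integrable hh, ?_⟩
  have : AEStronglyMeasurable h ((ℙ.prod μ).map (chX f k)) := by
    rw [l.map_eq]; exact hh.aestronglyMeasurable
  rw [← integral_map l.measurable.aemeasurable this, l.map_eq]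

lemma dgX_sq (hf : ∀ i, Measurable (f i)) (hp : ∀ i, 0 < p i) (hs : ∑ i, p i = 1)
    (hinv : (∑ i, ENNReal.ofReal (p i) • Measure.map (f i) μ) = μ)
    (hcyl : ∀ m : ℕ, ℙ.map (fun ω (k : Fin m) => ω k)
      = Measure.pi (fun _ : Fin m => ∑ j, ENNReal.ofReal (p j) • Measure.dirac j))
    (hg : Measurable g) (h3 : Integrable (fun x => |g x| ^ 3) μ) (k : ℕ) :
    Integrable (fun z : (ℕ → Fin N) × ℝ => dg f p g (z.1 k) (chX f k z) ^ 2) (ℙ.prod μ) ∧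
      ∫ z : (ℕ → Fin N) × ℝ, dg f p g (z.1 k) (chX f k z) ^ 2 ∂(ℙ.prod μ) = ∫ x, vv f p g x ∂μ := by
  have := markov hp hs hcyl (μ := μ) k (fun i z => dg f p g i (chX f k z) ^ 2)
    (fun i ω ω' x hd => by rw [chX_dep f k ω ω' x hd])
    (fun i => (chX_int hf hp hs hinv hcyl k
      (h := fun x => dg f p g i x ^ 2) (memLp3_2 (dg_memLp3 hf hp hinv hg h3 i)).integrable_sq).1)
  refine ⟨this.1, ?_⟩
  rw [this.2, ← (chX_int hf hp hs hinv hcyl k (vv_int hf hp hinv hg h3)).2]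
  rfl

lemma dgX_L2 (hf : ∀ i, Measurable (f i)) (hp : ∀ i, 0 < p i) (hs : ∑ i, p i = 1)
    (hinv : (∑ i, ENNReal.ofReal (p i) • Measure.map (f i) μ) = μ)
    (hcyl : ∀ m : ℕ, ℙ.map (fun ω (k : Fin m) => ω k)
      = Measure.pi (fun _ : Fin m => ∑ j, ENNReal.ofReal (p j) • Measure.dirac j))
    (hg : Measurable g) (h3 : Integrable (fun x => |g x| ^ 3) μ) (k : ℕ) :
    MemLp (fun z : (ℕ → Fin N) × ℝ => dg f p g (z.1 k) (chX f k z)) 2 (ℙ.prod μ) :=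
  (memLp_two_iff_integrable_sq (dgX_meas hf hg k).aestronglyMeasurable).2
    (dgX_sq hf hp hs hinv hcyl hg h3 k).1

lemma mM_sq (hf : ∀ i, Measurable (f i)) (hp : ∀ i, 0 < p i) (hs : ∑ i, p i = 1)
    (hinv : (∑ i, ENNReal.ofReal (p i) • Measure.map (f i) μ) = μ)
    (hcyl : ∀ m : ℕ, ℙ.map (fun ω (k : Fin m) => ω k)
      = Measure.pi (fun _ : Fin m => ∑ j, ENNReal.ofReal (p j) • Measure.dirac j))
    (hg : Measurable g) (h3 : Integrable (fun x => |g x| ^ 3) μ) (k : ℕ) :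
    MemLp (mM f p g k) 2 (ℙ.prod μ) ∧
      ∫ z, mM f p g k z ^ 2 ∂(ℙ.prod μ) = k * ∫ x, vv f p g x ∂μ := by
  have hM : ∀ k, MemLp (mM f p g k) 2 (ℙ.prod μ) := fun k =>
    memLp_finsetSum _ fun j _ => dgX_L2 hf hp hs hinv hcyl hg h3 j
  refine ⟨hM k, ?_⟩
  induction k with
  | zero => simp [mM]
  | succ k ih =>
    have hB : ∀ i, Integrable (fun z => mM f p g k z * dg f p g i (chX f k z)) (ℙ.prod μ) := fun i =>
      (hM k).integrable_mul ((memLp3_2 (dg_memLp3 hf hp hinv hg h3 i)).comp_measurePreserving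
        (chX_law hf hp hs hinv hcyl k))
    have c := markov hp hs hcyl (μ := μ) k (fun i z => mM f p g k z * dg f p g i (chX f k z))
      (fun i ω ω' x hd => by rw [chX_dep f k ω ω' x hd, mM_dep k ω ω' x hd]) hB
    have c0 : ∫ z, mM f p g k z * dg f p g (z.1 k) (chX f k z) ∂(ℙ.prod μ) = 0 := by
      rw [c.2]
      have : ∀ z, ∑ i, p i • (mM f p g k z * dg f p g i (chX f k z)) = 0 := fun z => by
        have := dg_sum (f := f) (p := p) (g := g) hs (chX f k z)
        calc _ = mM f p g k z * ∑ i, p i * dg f p g i (chX f k z) := by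
              rw [Finset.mul_sum]; refine Finset.sum_congr rfl fun i _ => ?_
              simp only [smul_eq_mul]; ring
          _ = 0 := by rw [this, mul_zero]
      simp only [this, integral_zero]
    have d := dgX_sq hf hp hs hinv hcyl hg h3 k
    have e : ∀ z, mM f p g (k+1) z ^ 2 = mM f p g k z ^ 2
        + (2 * (mM f p g k z * dg f p g (z.1 k) (chX f k z)) + dg f p g (z.1 k) (chX f k z) ^ 2) := fun z => by
      rw [mM_succ]; ring
    simp only [e]
    have i1 : Integrable (fun z => 2 * (mM f p g k z * dg f p g (z.1 k) (chX f k z))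
      + dg f p g (z.1 k) (chX f k z) ^ 2) (ℙ.prod μ) := (c.1.const_mul 2).add d.1
    rw [integral_add (hM k).integrable_sq i1,
      integral_add (c.1.const_mul 2) d.1, integral_const_mul, c0, d.2, ih]
    push_cast; ring

end dgs

noncomputable def zZ {N : ℕ} (f : Fin N → ℝ → ℝ) (p : Fin N → ℝ) (g : ℝ → ℝ) (u : ℝ) (k : ℕ)
    (z : (ℕ → Fin N) × ℝ) : ℂ :=
  Complex.exp (Complex.I * ((u * mM f p g k z : ℝ) : ℂ))

section zZs
variable {N : ℕ} {f : Fin N → ℝ → ℝ} {p : Fin N → ℝ} {g : ℝ → ℝ}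

lemma zZ_norm (u : ℝ) (k : ℕ) (z) : ‖zZ f p g u k z‖ = 1 := by
  rw [zZ, Complex.norm_exp_I_mul_ofReal]

lemma zZ_meas (hf : ∀ i, Measurable (f i)) (hg : Measurable g) (u : ℝ) (k : ℕ) :
    Measurable (zZ f p g u k) := by
  have := mM_meas (p := p) hf hg k
  unfold zZ
  fun_prop

lemma zZ_succ (u : ℝ) (k : ℕ) (z) : zZ f p g u (k+1) z
    = zZ f p g u k z * Complex.exp (Complex.I * ((u * dg f p g (z.1 k) (chX f k z) : ℝ) : ℂ)) := by
  rw [zZ, zZ, ← Complex.exp_add, mM_succ]; push_cast; ring_nf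

lemma zZ_dep (u : ℝ) (k : ℕ) (ω ω' : ℕ → Fin N) (x : ℝ)
    (h : ∀ j < k, ω j = ω' j) : zZ f p g u k (ω, x) = zZ f p g u k (ω', x) := by
  rw [zZ, zZ, mM_dep k ω ω' x h]

variable {ℙ : Measure (ℕ → Fin N)} [IsProbabilityMeasure ℙ] {μ : Measure ℝ} [IsProbabilityMeasure μ]

lemma zZ_mul_int (hf : ∀ i, Measurable (f i)) (hg : Measurable g) (u : ℝ) (k : ℕ)
    {h : (ℕ → Fin N) × ℝ → ℂ} (hh : Integrable h (ℙ.prod μ)) :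
    Integrable (fun z => zZ f p g u k z * h z) (ℙ.prod μ) :=
  hh.bdd_mul (zZ_meas hf hg u k).aestronglyMeasurable
    (Filter.Eventually.of_forall fun z => (zZ_norm u k z).le)

lemma zZ_int (hf : ∀ i, Measurable (f i)) (hg : Measurable g) (u : ℝ) (k : ℕ) :
    Integrable (zZ f p g u k) (ℙ.prod μ) :=
  Integrable.of_bound (C := 1) (zZ_meas hf hg u k).aestronglyMeasurable
    (Filter.Eventually.of_forall fun z => (zZ_norm u k z).le)

lemma step2 (hf : ∀ i, Measurable (f i)) (hp : ∀ i, 0 < p i) (hs : ∑ i, p i = 1)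
    (hinv : (∑ i, ENNReal.ofReal (p i) • Measure.map (f i) μ) = μ)
    (hcyl : ∀ m : ℕ, ℙ.map (fun ω (k : Fin m) => ω k)
      = Measure.pi (fun _ : Fin m => ∑ j, ENNReal.ofReal (p j) • Measure.dirac j))
    (hg : Measurable g) (h3 : Integrable (fun x => |g x| ^ 3) μ) (u : ℝ) (k : ℕ) :
    ‖(∫ z, zZ f p g u (k+1) z ∂(ℙ.prod μ)) - ∫ z, zZ f p g u k z *
      ((1 - u ^ 2 / 2 * vv f p g (chX f k z) : ℝ) : ℂ) ∂(ℙ.prod μ)‖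
      ≤ 4 * |u| ^ 3 * ∫ x, ∑ i, p i * |dg f p g i x| ^ 3 ∂μ := by
  have hK : Integrable (fun x => ∑ i, p i * |dg f p g i x| ^ 3) μ :=
    integrable_finsetSum _ fun i _ => (memLp3_int (dg_memLp3 hf hp hinv hg h3 i)).const_mul _
  have hBi : ∀ i, Integrable (fun z => zZ f p g u k z *
      Complex.exp (Complex.I * ((u * dg f p g i (chX f k z) : ℝ) : ℂ))) (ℙ.prod μ) := fun i => by
    refine zZ_mul_int hf hg u k ?_
    refine Integrable.of_bound (C := 1) ?_ (Filter.Eventually.of_forall fun z => ?_)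
    · have : Measurable fun z => dg f p g i (chX f k z) := (dg_meas hf hg i).comp (chX_measurable hf k)
      have : Measurable fun z => Complex.exp (Complex.I * ((u * dg f p g i (chX f k z) : ℝ) : ℂ)) := by
        fun_prop
      exact this.aestronglyMeasurable
    · rw [Complex.norm_exp_I_mul_ofReal]
  have m := markov hp hs hcyl (μ := μ) k (fun i z => zZ f p g u k z *
      Complex.exp (Complex.I * ((u * dg f p g i (chX f k z) : ℝ) : ℂ)))
      (fun i ω ω' x hd => by rw [chX_dep f k ω ω' x hd, zZ_dep u k ω ω' x hd]) hBi
  simp only [zZ_succ]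
  have i2 : Integrable (fun z => zZ f p g u k z *
      ((1 - u ^ 2 / 2 * vv f p g (chX f k z) : ℝ) : ℂ)) (ℙ.prod μ) := by
    refine zZ_mul_int hf hg u k (Integrable.ofReal ?_)
    exact (integrable_const _).sub
      ((chX_int hf hp hs hinv hcyl k (vv_int hf hp hinv hg h3)).1.const_mul _)
  have i1 : Integrable (fun z => ∑ i, p i • (zZ f p g u k z *
      Complex.exp (Complex.I * ((u * dg f p g i (chX f k z) : ℝ) : ℂ)))) (ℙ.prod μ) :=
    integrable_finsetSum _ fun i _ => (hBi i).smul (p i)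
  rw [m.2, ← integral_sub i1 i2, ← (chX_int hf hp hs hinv hcyl k hK).2, ← integral_const_mul]
  refine norm_integral_le_of_norm_le ((chX_int hf hp hs hinv hcyl k hK).1.const_mul _)
    (Filter.Eventually.of_forall fun z => ?_)
  have e : ∑ i, p i • (zZ f p g u k z *
      Complex.exp (Complex.I * ((u * dg f p g i (chX f k z) : ℝ) : ℂ))) - zZ f p g u k z *
      ((1 - u ^ 2 / 2 * vv f p g (chX f k z) : ℝ) : ℂ) = zZ f p g u k z *
      (∑ i, p i • Complex.exp (Complex.I * ((u * dg f p g i (chX f k z) : ℝ) : ℂ))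
        - ((1 - u ^ 2 / 2 * vv f p g (chX f k z) : ℝ) : ℂ)) := by
    rw [mul_sub, Finset.mul_sum]
    congr 1
    exact Finset.sum_congr rfl fun i _ => (mul_smul_comm _ _ _).symm
  rw [e, norm_mul, zZ_norm, one_mul]
  exact one_step hp hs (fun i => dg f p g i (chX f k z)) (dg_sum hs _) u

lemma step3 (hf : ∀ i, Measurable (f i)) (hp : ∀ i, 0 < p i) (hs : ∑ i, p i = 1)
    (hae : ∀ᵐ x ∂μ, x ∈ Ioo (0:ℝ) 1)
    (hinv : (∑ i, ENNReal.ofReal (p i) • Measure.map (f i) μ) = μ)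
    (hcyl : ∀ m : ℕ, ℙ.map (fun ω (k : Fin m) => ω k)
      = Measure.pi (fun _ : Fin m => ∑ j, ENNReal.ofReal (p j) • Measure.dirac j))
    (hg : Measurable g) (h3 : Integrable (fun x => |g x| ^ 3) μ)
    {w ψ : ℝ → ℝ} (hw : Measurable w) (hw3 : Integrable (fun x => |w x| ^ 3) μ)
    (hψ : Integrable ψ μ) (hwψ : ∀ x ∈ Ioo (0:ℝ) 1, w x - UL f p w x = ψ x) (u : ℝ) (k : ℕ) :
    ‖(∫ z, zZ f p g u k z * (ψ (chX f k z) : ℂ) ∂(ℙ.prod μ))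
      - ((∫ z, zZ f p g u k z * (w (chX f k z) : ℂ) ∂(ℙ.prod μ))
        - ∫ z, zZ f p g u (k+1) z * (w (chX f (k+1) z) : ℂ) ∂(ℙ.prod μ))‖
      ≤ |u| * ((∫ x, vv f p g x ∂μ) + ∫ x, w x ^ 2 ∂μ) := by
  have w3 := memLp3 hw hw3
  have w2 := memLp3_2 w3
  have w1 : Integrable w μ := w2.integrable (by norm_num)
  have hX := fun k => chX_law hf hp hs hinv hcyl (μ := μ) (ℙ := ℙ) k
  have hBi : ∀ i, Integrable (fun z => zZ f p g u k z * (w (f i (chX f k z)) : ℂ)) (ℙ.prod μ) := fun i =>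
    zZ_mul_int hf hg u k (Integrable.ofReal
      (chX_int hf hp hs hinv hcyl k (inv_integrable' hf hp hinv w1 i)).1)
  have m := markov hp hs hcyl (μ := μ) k (fun i z => zZ f p g u k z * (w (f i (chX f k z)) : ℂ))
      (fun i ω ω' x hd => by rw [chX_dep f k ω ω' x hd, zZ_dep u k ω ω' x hd]) hBi
  have iw : ∀ j l, Integrable (fun z => zZ f p g u j z * (w (chX f l z) : ℂ)) (ℙ.prod μ) := fun j l =>
    zZ_mul_int hf hg u j (Integrable.ofReal (chX_int hf hp hs hinv hcyl l w1).1)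
  have iψ : Integrable (fun z => zZ f p g u k z * (ψ (chX f k z) : ℂ)) (ℙ.prod μ) :=
    zZ_mul_int hf hg u k (Integrable.ofReal (chX_int hf hp hs hinv hcyl k hψ).1)
  have e1 : (∫ z, zZ f p g u k z * (w (chX f (k+1) z) : ℂ) ∂(ℙ.prod μ))
      = (∫ z, zZ f p g u k z * (w (chX f k z) : ℂ) ∂(ℙ.prod μ))
        - ∫ z, zZ f p g u k z * (ψ (chX f k z) : ℂ) ∂(ℙ.prod μ) := by
    simp only [chX_succ]
    rw [m.2, ← integral_sub (iw k k) iψ]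
    refine integral_congr_ae ?_
    have : ∀ᵐ z ∂(ℙ.prod μ), chX f k z ∈ Ioo (0:ℝ) 1 := (hX k).quasiMeasurePreserving.ae hae
    filter_upwards [this] with z hz
    rw [← hwψ _ hz, UL_apply]
    push_cast
    simp only [Complex.real_smul]
    rw [← mul_sub, sub_sub_cancel, Finset.mul_sum]
    exact Finset.sum_congr rfl fun i _ => by ring
  have e2 : (∫ z, zZ f p g u k z * (ψ (chX f k z) : ℂ) ∂(ℙ.prod μ))
      - ((∫ z, zZ f p g u k z * (w (chX f k z) : ℂ) ∂(ℙ.prod μ))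
        - ∫ z, zZ f p g u (k+1) z * (w (chX f (k+1) z) : ℂ) ∂(ℙ.prod μ))
      = ∫ z, (zZ f p g u (k+1) z * (w (chX f (k+1) z) : ℂ)
          - zZ f p g u k z * (w (chX f (k+1) z) : ℂ)) ∂(ℙ.prod μ) := by
    rw [integral_sub (iw (k+1) (k+1)) (iw k (k+1)), e1]; ring
  have d := dgX_sq hf hp hs hinv hcyl hg h3 k (ℙ := ℙ) (μ := μ)
  have c := chX_int hf hp hs hinv hcyl (ℙ := ℙ) (k+1) (h := fun x => w x ^ 2) w2.integrable_sq
  rw [e2, ← d.2, ← c.2, ← integral_add d.1 c.1, ← integral_const_mul]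
  refine norm_integral_le_of_norm_le ((d.1.add c.1).const_mul _)
    (Filter.Eventually.of_forall fun z => ?_)
  rw [zZ_succ]
  set D := dg f p g (z.1 k) (chX f k z)
  set y := w (chX f (k+1) z)
  have e3 : zZ f p g u k z * Complex.exp (Complex.I * ((u * D : ℝ) : ℂ)) * (y : ℂ) - zZ f p g u k z * (y : ℂ)
    = zZ f p g u k z * (Complex.exp (Complex.I * ((u * D : ℝ) : ℂ)) - 1) * (y : ℂ) := by ring
  rw [e3, norm_mul, norm_mul, zZ_norm, one_mul, Complex.norm_real]
  have a1 := Real.norm_exp_I_mul_ofReal_sub_one_le (x := u * D)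
  calc _ ≤ ‖u * D‖ * ‖y‖ := by gcongr
    _ = |u| * (|D| * |y|) := by rw [Real.norm_eq_abs, Real.norm_eq_abs, abs_mul, mul_assoc]
    _ ≤ |u| * (D ^ 2 + y ^ 2) := by
      gcongr
      have := sq_abs D
      have := sq_abs y
      nlinarith [sq_nonneg (|D| - |y|), sq_nonneg D, sq_nonneg y]

lemma mart_clt {d e : Fin N → ℝ} (H : AdmissibleIFS N f p d e)
    (hae : ∀ᵐ x ∂μ, x ∈ Ioo (0:ℝ) 1)
    (hinv : (∑ i, ENNReal.ofReal (p i) • Measure.map (f i) μ) = μ)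
    (hcyl : ∀ m : ℕ, ℙ.map (fun ω (k : Fin m) => ω k)
      = Measure.pi (fun _ : Fin m => ∑ j, ENNReal.ofReal (p j) • Measure.dirac j))
    (hg : Measurable g) (h3 : Integrable (fun x => |g x| ^ 3) μ) (t : ℝ) :
    Tendsto (fun n : ℕ => ∫ z, zZ f p g (t / Real.sqrt n) n z ∂(ℙ.prod μ)) atTop
      (nhds (Complex.exp (-((∫ x, vv f p g x ∂μ : ℝ) * t ^ 2 / 2)))) := by
  have hf := H.meas
  have hp := H.ppos
  have hs := H.psum
  have hvi := vv_int hf hp hinv hg h3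
  set s2 := ∫ x, vv f p g x ∂μ with hs2
  have hs2n : 0 ≤ s2 := integral_nonneg fun x => vv_nonneg hp x
  refine clt_abstract (fun u k => ∫ z, zZ f p g u k z ∂(ℙ.prod μ)) s2 hs2n ?_ ?_ t
  · intro u; simp [zZ, mM]
  intro ε hε
  obtain ⟨ψ, L, hL, hψm, hψL, hψi, hψ0, hψε⟩ := approx_lip hae (vv f p g) hvi ε hε
  obtain ⟨w, hw, hw3, hwψ⟩ := poisson H hinv hae ψ L hL hψm hψL hψ0
  have w2 := memLp3_2 (memLp3 hw hw3)
  have w1 : Integrable w μ := w2.integrable (by norm_num)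
  set K3 := ∫ x, ∑ i, p i * |dg f p g i x| ^ 3 ∂μ with hK3
  have hK3n : 0 ≤ K3 := integral_nonneg fun x =>
    Finset.sum_nonneg fun i _ => mul_nonneg (hp i).le (by positivity)
  set A1 := ∫ x, |w x| ∂μ with hA1
  set A2 := ∫ x, w x ^ 2 ∂μ with hA2
  have hA1n : 0 ≤ A1 := integral_nonneg fun x => abs_nonneg _
  have hA2n : 0 ≤ A2 := integral_nonneg fun x => sq_nonneg _
  refine ⟨4 * K3 + (s2 + A2) + A1 + s2 * A1, by positivity, fun u => ?_⟩
  have hW : ∀ k, ‖∫ z, zZ f p g u k z * (w (chX f k z) : ℂ) ∂(ℙ.prod μ)‖ ≤ A1 := fun k => by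
    have c := chX_int hf hp hs hinv hcyl (ℙ := ℙ) k (h := fun x => |w x|) w1.abs
    rw [hA1, ← c.2]
    refine norm_integral_le_of_norm_le c.1 (Filter.Eventually.of_forall fun z => ?_)
    rw [norm_mul, zZ_norm, one_mul, Complex.norm_real, Real.norm_eq_abs]
  refine ⟨fun k => ((u ^ 2 / 2 : ℝ) : ℂ) * ∫ z, zZ f p g u k z * (w (chX f k z) : ℂ) ∂(ℙ.prod μ),
    fun k => ?_, fun k => ?_⟩
  · rw [norm_mul, Complex.norm_real, Real.norm_eq_abs, abs_of_nonneg (by positivity)]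
    have := hW k
    have h0 := norm_nonneg (∫ z, zZ f p g u k z * (w (chX f k z) : ℂ) ∂(ℙ.prod μ))
    nlinarith [mul_le_mul_of_nonneg_left this (sq_nonneg u), mul_nonneg (sq_nonneg u) hK3n,
      mul_nonneg (sq_nonneg u) hs2n, mul_nonneg (sq_nonneg u) hA2n, mul_nonneg (sq_nonneg u) hA1n,
      mul_nonneg (sq_nonneg u) (mul_nonneg hs2n hA1n)]
  · have E2 := step2 hf hp hs hinv hcyl hg h3 u k (ℙ := ℙ)
    have E3 := step3 hf hp hs hae hinv hcyl hg h3 hw hw3 hψi hwψ u k (ℙ := ℙ)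
    have iψ : Integrable (fun z => zZ f p g u k z * (ψ (chX f k z) : ℂ)) (ℙ.prod μ) :=
      zZ_mul_int hf hg u k (Integrable.ofReal (chX_int hf hp hs hinv hcyl k hψi).1)
    have iZ : Integrable (zZ f p g u k) (ℙ.prod μ) := zZ_int hf hg u k
    have iδ0 : Integrable (fun x => vv f p g x - s2 - ψ x) μ := (hvi.sub (integrable_const _)).sub hψi
    have iδ : Integrable (fun z => zZ f p g u k z *
        ((vv f p g (chX f k z) - s2 - ψ (chX f k z) : ℝ) : ℂ)) (ℙ.prod μ) :=
      zZ_mul_int hf hg u k (Integrable.ofReal (chX_int hf hp hs hinv hcyl k iδ0).1)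
    have E4 : ‖∫ z, zZ f p g u k z *
        ((vv f p g (chX f k z) - s2 - ψ (chX f k z) : ℝ) : ℂ) ∂(ℙ.prod μ)‖ ≤ ε := by
      have c := chX_int hf hp hs hinv hcyl (ℙ := ℙ) k (h := fun x => |vv f p g x - s2 - ψ x|) iδ0.abs
      refine le_trans ?_ hψε
      rw [← c.2]
      refine norm_integral_le_of_norm_le c.1 (Filter.Eventually.of_forall fun z => ?_)
      rw [norm_mul, zZ_norm, one_mul, Complex.norm_real, Real.norm_eq_abs]
    have e5 : ∫ z, zZ f p g u k z * ((1 - u ^ 2 / 2 * vv f p g (chX f k z) : ℝ) : ℂ) ∂(ℙ.prod μ)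
        = ((1 - u ^ 2 / 2 * s2 : ℝ) : ℂ) * (∫ z, zZ f p g u k z ∂(ℙ.prod μ))
          - ((u ^ 2 / 2 : ℝ) : ℂ) * ((∫ z, zZ f p g u k z * (ψ (chX f k z) : ℂ) ∂(ℙ.prod μ))
          + ∫ z, zZ f p g u k z *
            ((vv f p g (chX f k z) - s2 - ψ (chX f k z) : ℝ) : ℂ) ∂(ℙ.prod μ)) := by
      have i3 : Integrable (fun z => zZ f p g u k z * (ψ (chX f k z) : ℂ) + zZ f p g u k z *
        ((vv f p g (chX f k z) - s2 - ψ (chX f k z) : ℝ) : ℂ)) (ℙ.prod μ) := iψ.add iδ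
      rw [← integral_add iψ iδ, ← integral_const_mul (((1 - u ^ 2 / 2 * s2 : ℝ) : ℂ)),
        ← integral_const_mul (((u ^ 2 / 2 : ℝ) : ℂ)),
        ← integral_sub (iZ.const_mul _) (i3.const_mul _)]
      refine integral_congr_ae (Filter.Eventually.of_forall fun z => ?_)
      simp only
      push_cast
      ring
    rw [e5] at E2
    have hWk := hW k
    set a1 := ∫ z, zZ f p g u (k+1) z ∂(ℙ.prod μ)
    set a0 := ∫ z, zZ f p g u k z ∂(ℙ.prod μ)
    set W0 := ∫ z, zZ f p g u k z * (w (chX f k z) : ℂ) ∂(ℙ.prod μ)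
    set W1 := ∫ z, zZ f p g u (k+1) z * (w (chX f (k+1) z) : ℂ) ∂(ℙ.prod μ)
    set P0 := ∫ z, zZ f p g u k z * (ψ (chX f k z) : ℂ) ∂(ℙ.prod μ)
    set Q0 := ∫ z, zZ f p g u k z *
            ((vv f p g (chX f k z) - s2 - ψ (chX f k z) : ℝ) : ℂ) ∂(ℙ.prod μ)
    have key : (a1 - ((u ^ 2 / 2 : ℝ) : ℂ) * W1) - ((1 - u ^ 2 * s2 / 2 : ℝ) : ℂ) * (a0 - ((u ^ 2 / 2 : ℝ) : ℂ) * W0)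
        = (a1 - (((1 - u ^ 2 / 2 * s2 : ℝ) : ℂ) * a0 - ((u ^ 2 / 2 : ℝ) : ℂ) * (P0 + Q0)))
          - ((u ^ 2 / 2 : ℝ) : ℂ) * (P0 - (W0 - W1)) - ((u ^ 2 / 2 : ℝ) : ℂ) * Q0
          - ((u ^ 4 * s2 / 4 : ℝ) : ℂ) * W0 := by
      push_cast; ring
    simp only
    rw [key]
    have nr : ∀ (r : ℝ) (c : ℂ), 0 ≤ r → ‖(r : ℂ) * c‖ = r * ‖c‖ := fun r c hr => by
      rw [norm_mul, Complex.norm_real, Real.norm_eq_abs, abs_of_nonneg hr]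
    have t1 : ‖((u ^ 2 / 2 : ℝ) : ℂ) * (P0 - (W0 - W1))‖ ≤ u ^ 2 / 2 * (|u| * (s2 + A2)) := by
      rw [nr _ _ (by positivity)]; gcongr
    have t2 : ‖((u ^ 2 / 2 : ℝ) : ℂ) * Q0‖ ≤ u ^ 2 / 2 * ε := by
      rw [nr _ _ (by positivity)]; gcongr
    have t3 : ‖((u ^ 4 * s2 / 4 : ℝ) : ℂ) * W0‖ ≤ u ^ 4 * s2 / 4 * A1 := by
      rw [nr _ _ (by positivity)]; gcongr
    have T := norm_sub_le ((a1 - (((1 - u ^ 2 / 2 * s2 : ℝ) : ℂ) * a0 - ((u ^ 2 / 2 : ℝ) : ℂ) * (P0 + Q0)))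
          - ((u ^ 2 / 2 : ℝ) : ℂ) * (P0 - (W0 - W1)) - ((u ^ 2 / 2 : ℝ) : ℂ) * Q0)
          (((u ^ 4 * s2 / 4 : ℝ) : ℂ) * W0)
    have T2 := norm_sub_le ((a1 - (((1 - u ^ 2 / 2 * s2 : ℝ) : ℂ) * a0 - ((u ^ 2 / 2 : ℝ) : ℂ) * (P0 + Q0)))
          - ((u ^ 2 / 2 : ℝ) : ℂ) * (P0 - (W0 - W1))) (((u ^ 2 / 2 : ℝ) : ℂ) * Q0)
    have T3 := norm_sub_le (a1 - (((1 - u ^ 2 / 2 * s2 : ℝ) : ℂ) * a0 - ((u ^ 2 / 2 : ℝ) : ℂ) * (P0 + Q0)))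
          (((u ^ 2 / 2 : ℝ) : ℂ) * (P0 - (W0 - W1)))
    have hu : u ^ 2 / 2 * (|u| * (s2 + A2)) = |u| ^ 3 / 2 * (s2 + A2) := by
      rw [← sq_abs u]; ring
    rw [hu] at t1
    have p1 : 0 ≤ u ^ 2 * ε := by positivity
    have p2 : 0 ≤ |u| ^ 3 * (s2 + A2) := by positivity
    have p3 : 0 ≤ |u| ^ 3 * (A1 + s2 * A1) := by positivity
    have p4 : 0 ≤ u ^ 4 * (4 * K3 + (s2 + A2) + A1) := by positivity
    have p5 : 0 ≤ u ^ 4 * (s2 * A1) := by positivity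
    nlinarith

end zZs

noncomputable def rR {N : ℕ} (f : Fin N → ℝ → ℝ) (p : Fin N → ℝ) (g : ℝ → ℝ) (n : ℕ)
    (z : (ℕ → Fin N) × ℝ) : ℝ := g (chX f 0 z) - UL f p g (chX f n z)

section fin
variable {N : ℕ} {f : Fin N → ℝ → ℝ} {p : Fin N → ℝ} {g : ℝ → ℝ}

lemma decomp {d e : Fin N → ℝ} (H : AdmissibleIFS N f p d e) {φ : ℝ → ℝ}
    (hgφ : ∀ x ∈ Ioo (0:ℝ) 1, g x - UL f p g x = φ x) (z : (ℕ → Fin N) × ℝ) (hz : z.2 ∈ Ioo (0:ℝ) 1)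
    (n : ℕ) : ∑ k ∈ range (n+1), φ (chX f k z) = mM f p g n z + rR f p g n z := by
  have hk : ∀ k, chX f k z ∈ Ioo (0:ℝ) 1 := fun k => by
    induction k with
    | zero => exact hz
    | succ k ih => rw [chX_succ]; exact adm_maps H _ ih
  induction n with
  | zero => simp [mM, rR, hgφ _ (hk 0)]
  | succ n ih =>
    rw [Finset.sum_range_succ, ih, ← hgφ _ (hk (n+1)), mM_succ, rR, rR, dg, chX_succ f n z]
    ring

variable {ℙ : Measure (ℕ → Fin N)} [IsProbabilityMeasure ℙ] {μ : Measure ℝ} [IsProbabilityMeasure μ]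

lemma rR_L2 (hf : ∀ i, Measurable (f i)) (hp : ∀ i, 0 < p i) (hs : ∑ i, p i = 1)
    (hinv : (∑ i, ENNReal.ofReal (p i) • Measure.map (f i) μ) = μ)
    (hcyl : ∀ m : ℕ, ℙ.map (fun ω (k : Fin m) => ω k)
      = Measure.pi (fun _ : Fin m => ∑ j, ENNReal.ofReal (p j) • Measure.dirac j))
    (hg : Measurable g) (h3 : Integrable (fun x => |g x| ^ 3) μ) :
    ∃ C : ℝ, 0 ≤ C ∧ ∀ n, MemLp (rR f p g n) 2 (ℙ.prod μ) ∧ ∫ z, rR f p g n z ^ 2 ∂(ℙ.prod μ) ≤ C := by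
  have g2 := memLp3_2 (memLp3 hg h3)
  have u2 := memLp3_2 (UL_memLp3 hf hp hinv hg h3)
  have hX := fun k => chX_law hf hp hs hinv hcyl (μ := μ) (ℙ := ℙ) k
  refine ⟨2 * (∫ x, g x ^ 2 ∂μ) + 2 * ∫ x, UL f p g x ^ 2 ∂μ, ?_, fun n => ?_⟩
  · have := integral_nonneg (μ := μ) (f := fun x => g x ^ 2) fun x => sq_nonneg _
    have := integral_nonneg (μ := μ) (f := fun x => UL f p g x ^ 2) fun x => sq_nonneg _
    positivity
  have hR : MemLp (rR f p g n) 2 (ℙ.prod μ) :=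
    (g2.comp_measurePreserving (hX 0)).sub (u2.comp_measurePreserving (hX n))
  refine ⟨hR, ?_⟩
  have c1 := chX_int hf hp hs hinv hcyl (ℙ := ℙ) 0 (h := fun x => g x ^ 2) g2.integrable_sq
  have c2 := chX_int hf hp hs hinv hcyl (ℙ := ℙ) n (h := fun x => UL f p g x ^ 2) u2.integrable_sq
  rw [← c1.2, ← c2.2, ← integral_const_mul, ← integral_const_mul,
    ← integral_add (c1.1.const_mul 2) (c2.1.const_mul 2)]
  refine integral_mono hR.integrable_sq ((c1.1.const_mul 2).add (c2.1.const_mul 2)) fun z => ?_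
  simp only [rR]
  nlinarith [sq_nonneg (g (chX f 0 z) + UL f p g (chX f n z))]

lemma var_abs {Ω : Type*} [MeasurableSpace Ω] {Q : Measure Ω} [IsProbabilityMeasure Q]
    (M R : ℕ → Ω → ℝ) (s2 C : ℝ) (hM : ∀ n, MemLp (M n) 2 Q) (hR : ∀ n, MemLp (R n) 2 Q)
    (hMs : ∀ n : ℕ, ∫ z, M n z ^ 2 ∂Q = n * s2) (hRC : ∀ n, ∫ z, R n z ^ 2 ∂Q ≤ C) :
    Tendsto (fun n : ℕ => ∫ z, ((M n z + R n z) / Real.sqrt n) ^ 2 ∂Q) atTop (nhds s2) := by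
  have hsq : Tendsto (fun n : ℕ => Real.sqrt n) atTop atTop :=
    Real.tendsto_sqrt_atTop.comp tendsto_natCast_atTop_atTop
  have hlim : Tendsto (fun n : ℕ => s2 / Real.sqrt n + C / Real.sqrt n + C / n) atTop (nhds 0) := by
    simpa using ((hsq.const_div_atTop s2).add (hsq.const_div_atTop C)).add
      ((tendsto_natCast_atTop_atTop (R := ℝ)).const_div_atTop C)
  rw [tendsto_iff_norm_sub_tendsto_zero]
  refine squeeze_zero' (Filter.Eventually.of_forall fun n => norm_nonneg _) ?_ hlim
  filter_upwards [eventually_ge_atTop 1] with n hn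
  have hn0 : (0:ℝ) < n := by exact_mod_cast hn
  set s := Real.sqrt n with hs
  have hs0 : 0 < s := Real.sqrt_pos.2 hn0
  have hss : (n:ℝ) = s ^ 2 := (Real.sq_sqrt hn0.le).symm
  have iMR : Integrable (fun z => M n z * R n z) Q := (hM n).integrable_mul (hR n)
  have iM := (hM n).integrable_sq
  have iR := (hR n).integrable_sq
  have e1 : ∫ z, ((M n z + R n z) / s) ^ 2 ∂Q
      = (n * s2 + (2 * (∫ z, M n z * R n z ∂Q) + ∫ z, R n z ^ 2 ∂Q)) / n := by
    have i3 : Integrable (fun z => 2 * (M n z * R n z) + R n z ^ 2) Q := (iMR.const_mul 2).add iR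
    rw [← hMs, ← integral_const_mul, ← integral_add (iMR.const_mul 2) iR, ← integral_add iM i3,
      ← integral_div]
    refine integral_congr_ae (Filter.Eventually.of_forall fun z => ?_)
    simp only
    rw [hss]; ring
  have e2 : |∫ z, M n z * R n z ∂Q| ≤ ((∫ z, M n z ^ 2 ∂Q) / s + s * ∫ z, R n z ^ 2 ∂Q) / 2 := by
    rw [← integral_div, ← integral_const_mul, ← integral_add (iM.div_const s) (iR.const_mul s),
      ← integral_div]
    refine (abs_integral_le_integral_abs).trans (integral_mono iMR.abs
      (((iM.div_const s).add (iR.const_mul s)).div_const 2) fun z => ?_)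
    simp only [Pi.add_apply]
    have : M n z ^ 2 / s + s * R n z ^ 2 = (M n z ^ 2 + (s * R n z) ^ 2) / s := by field_simp
    rw [this, div_div, le_div_iff₀ (by positivity), abs_mul]
    nlinarith [sq_nonneg (|M n z| - s * |R n z|), sq_abs (M n z), sq_abs (R n z)]
  have hR0 : 0 ≤ ∫ z, R n z ^ 2 ∂Q := integral_nonneg fun z => sq_nonneg _
  have hRC' := hRC n
  rw [hMs] at e2
  rw [e1, Real.norm_eq_abs]
  have e3 : (n * s2 + (2 * (∫ z, M n z * R n z ∂Q) + ∫ z, R n z ^ 2 ∂Q)) / n - s2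
    = (2 * (∫ z, M n z * R n z ∂Q) + ∫ z, R n z ^ 2 ∂Q) / n := by field_simp; ring
  rw [e3, abs_div, abs_of_pos hn0, div_le_iff₀ hn0]
  have e4 : (s2 / s + C / s + C / n) * n = n * s2 / s + s * C + C := by
    rw [hss]; field_simp
  rw [e4]
  refine (abs_add_le _ _).trans ?_
  rw [abs_mul, abs_two, abs_of_nonneg hR0]
  have := mul_le_mul_of_nonneg_left hRC' hs0.le
  linarith

lemma exp_diff (a b : ℝ) : ‖Complex.exp (Complex.I * ((a + b : ℝ) : ℂ)) - Complex.exp (Complex.I * (a : ℂ))‖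
    ≤ |b| := by
  have : Complex.exp (Complex.I * ((a + b : ℝ) : ℂ)) - Complex.exp (Complex.I * (a : ℂ))
    = Complex.exp (Complex.I * (a : ℂ)) * (Complex.exp (Complex.I * (b : ℂ)) - 1) := by
    rw [mul_sub, ← Complex.exp_add, mul_one]; push_cast; ring_nf
  rw [this, norm_mul, Complex.norm_exp_I_mul_ofReal, one_mul]
  exact Real.norm_exp_I_mul_ofReal_sub_one_le

lemma char_abs {Ω : Type*} [MeasurableSpace Ω] {Q : Measure Ω} [IsProbabilityMeasure Q]
    (M R : ℕ → Ω → ℝ) (C t : ℝ) (l : ℂ) (hM : ∀ n, Measurable (M n)) (hR : ∀ n, Measurable (R n))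
    (hR2 : ∀ n, MemLp (R n) 2 Q) (hRC : ∀ n, ∫ z, R n z ^ 2 ∂Q ≤ C)
    (hl : Tendsto (fun n : ℕ => ∫ z, Complex.exp (Complex.I * ((t / Real.sqrt n * M n z : ℝ) : ℂ)) ∂Q)
      atTop (nhds l)) :
    Tendsto (fun n : ℕ => ∫ z, Complex.exp (t * (((M n z + R n z) / Real.sqrt n : ℝ) : ℂ) * Complex.I) ∂Q)
      atTop (nhds l) := by
  have hsq : Tendsto (fun n : ℕ => Real.sqrt n) atTop atTop :=
    Real.tendsto_sqrt_atTop.comp tendsto_natCast_atTop_atTop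
  have hlim : Tendsto (fun n : ℕ => |t| * (1 + C) / Real.sqrt n) atTop (nhds 0) :=
    hsq.const_div_atTop _
  have hm : ∀ h : Ω → ℝ, Measurable h → Integrable (fun z => Complex.exp (Complex.I * (h z : ℂ))) Q := by
    intro h hh
    refine Integrable.of_bound (C := 1) ?_ (Filter.Eventually.of_forall fun z => ?_)
    · have : Measurable fun z => Complex.exp (Complex.I * (h z : ℂ)) := by fun_prop
      exact this.aestronglyMeasurable
    · rw [Complex.norm_exp_I_mul_ofReal]
  have hd : Tendsto (fun n : ℕ => (∫ z, Complex.exp (t * (((M n z + R n z) / Real.sqrt n : ℝ) : ℂ) * Complex.I) ∂Q)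
      - ∫ z, Complex.exp (Complex.I * ((t / Real.sqrt n * M n z : ℝ) : ℂ)) ∂Q) atTop (nhds 0) := by
    refine squeeze_zero_norm (fun n => ?_) hlim
    have e : ∀ z, Complex.exp (t * (((M n z + R n z) / Real.sqrt n : ℝ) : ℂ) * Complex.I)
        = Complex.exp (Complex.I * ((t / Real.sqrt n * M n z + t / Real.sqrt n * R n z : ℝ) : ℂ)) := fun z => by
      congr 1; push_cast; ring
    simp only [e]
    have hMn := hM n
    have hRn := hR n
    rw [← integral_sub (hm _ (by fun_prop)) (hm _ (by fun_prop))]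
    have iR := (hR2 n).integrable_sq
    have i1 : Integrable (fun z => |t| / Real.sqrt n * (1 + R n z ^ 2)) Q :=
      ((integrable_const _).add iR).const_mul _
    refine (norm_integral_le_of_norm_le i1 (Filter.Eventually.of_forall fun z => ?_)).trans ?_
    · refine (exp_diff _ _).trans ?_
      rw [abs_mul, abs_div, abs_of_nonneg (Real.sqrt_nonneg _)]
      gcongr
      nlinarith [sq_nonneg (|R n z| - 1), sq_abs (R n z)]
    · rw [integral_const_mul, integral_add (integrable_const _) iR]
      simp only [integral_const, probReal_univ, smul_eq_mul, one_mul]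
      rw [mul_div_right_comm]
      gcongr
      exact hRC n
  simpa using hd.add hl

end fin

/-- (Annealed CLT.) For the stationary chain `X_k(ω,x) = f_ω^k(x)`
(on the product of the i.i.d. word space and `[0,1]` with the invariant initial
distribution `μ*`) and a Lipschitz `φ` with `∫ φ dμ* = 0`, the normalized variance of
`(φ(X₀)+⋯+φ(X_n))/√n` converges to some `σ² ≥ 0` and the normalized sums converge in
distribution to `N(0, σ²)`. -/
theorem stmt17 (N : ℕ) (f : Fin N → ℝ → ℝ) (p d e : Fin N → ℝ)
    (hadm : AdmissibleIFS N f p d e)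
    (μstar : Measure ℝ) (hprob : IsProbabilityMeasure μstar)
    (hμ01 : μstar (Ioo (0:ℝ) 1) = 1)
    (hinv : (∑ i, ENNReal.ofReal (p i) • Measure.map (f i) μstar) = μstar)
    (huniq : ∀ ν : Measure ℝ, IsProbabilityMeasure ν → ν (Ioo (0:ℝ) 1) = 1 →
      (∑ i, ENNReal.ofReal (p i) • Measure.map (f i) ν) = ν → ν = μstar)
    -- `ℙ` is the product measure on `Σ = {1,…,N}^ℕ` with marginals `p`
    (ℙ : Measure (ℕ → Fin N)) (hPprob : IsProbabilityMeasure ℙ)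
    (hcyl : ∀ m : ℕ, ℙ.map (fun ω (k : Fin m) => ω k)
      = Measure.pi (fun _ : Fin m => ∑ j, ENNReal.ofReal (p j) • Measure.dirac j))
    (φ : ℝ → ℝ) (L : ℝ) (hL : 0 ≤ L) (hφmeas : Measurable φ)
    (hφ : ∀ a ∈ Icc (0:ℝ) 1, ∀ b ∈ Icc (0:ℝ) 1, |φ a - φ b| ≤ L * |a - b|)
    (hφ0 : ∫ x, φ x ∂μstar = 0) :
    ∃ σ2 : NNReal,
      Tendsto (fun n : ℕ => ∫ z : (ℕ → Fin N) × ℝ,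
          ((∑ k ∈ Finset.range (n + 1), φ (wordIter f z.1 k z.2)) / Real.sqrt n) ^ 2
            ∂(ℙ.prod μstar))
        atTop (nhds (σ2 : ℝ)) ∧
      ∀ g : BoundedContinuousFunction ℝ ℝ,
        Tendsto (fun n : ℕ => ∫ z : (ℕ → Fin N) × ℝ,
            g ((∑ k ∈ Finset.range (n + 1), φ (wordIter f z.1 k z.2)) / Real.sqrt n)
              ∂(ℙ.prod μstar))
          atTop (nhds (∫ y, g y ∂(ProbabilityTheory.gaussianReal 0 σ2))) := by
  have hae : ∀ᵐ x ∂μstar, x ∈ Ioo (0:ℝ) 1 := (mem_ae_iff_prob_eq_one measurableSet_Ioo).2 hμ01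
  obtain ⟨g, hg, h3, hgφ⟩ := poisson hadm hinv hae φ L hL hφmeas hφ hφ0
  have hf := hadm.meas
  have hp := hadm.ppos
  have hs := hadm.psum
  set Q := ℙ.prod μstar with hQ
  have hs2 : 0 ≤ ∫ x, vv f p g x ∂μstar := integral_nonneg fun x => vv_nonneg hp x
  set s2 := ∫ x, vv f p g x ∂μstar with hs2d
  obtain ⟨C, hC, hR⟩ := rR_L2 hf hp hs hinv hcyl hg h3
  have hM := fun n => mM_sq hf hp hs hinv hcyl hg h3 n
  have hMm : ∀ n, Measurable (mM f p g n) := fun n => mM_meas hf hg n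
  have hRm : ∀ n, Measurable (rR f p g n) := fun n =>
    (hg.comp (chX_measurable hf 0)).sub ((UL_measurable hf hg).comp (chX_measurable hf n))
  have haeQ : ∀ᵐ z ∂Q, z.2 ∈ Ioo (0:ℝ) 1 :=
    (measurePreserving_snd (μ := ℙ) (ν := μstar)).quasiMeasurePreserving.ae hae
  have hdec : ∀ n : ℕ, ∀ᵐ z ∂Q, ∑ k ∈ Finset.range (n + 1), φ (wordIter f z.1 k z.2)
      = mM f p g n z + rR f p g n z := fun n => by
    filter_upwards [haeQ] with z hz
    exact decomp hadm hgφ z hz n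
  obtain ⟨σ, hσ⟩ : ∃ σ : NNReal, (σ : ℝ) = s2 := ⟨s2.toNNReal, Real.coe_toNNReal _ hs2⟩
  refine ⟨σ, ?_, fun G => ?_⟩
  · rw [hσ]
    refine (var_abs (Q := Q) (mM f p g) (rR f p g) s2 C (fun n => (hM n).1) (fun n => (hR n).1)
      (fun n => (hM n).2) (fun n => (hR n).2)).congr fun n => ?_
    refine integral_congr_ae ?_
    filter_upwards [hdec n] with z hz
    rw [hz]
  · set F : ℕ → (ℕ → Fin N) × ℝ → ℝ := fun n z => (mM f p g n z + rR f p g n z) / Real.sqrt n with hF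
    have hFm : ∀ n, Measurable (F n) := fun n => ((hMm n).add (hRm n)).div_const _
    have hlaw : ∀ n, IsProbabilityMeasure (Q.map (F n)) := fun n =>
      Measure.isProbabilityMeasure_map (hFm n).aemeasurable
    let P : ℕ → ProbabilityMeasure ℝ := fun n => ⟨Q.map (F n), hlaw n⟩
    let P0 : ProbabilityMeasure ℝ := ⟨ProbabilityTheory.gaussianReal 0 σ, inferInstance⟩
    have hconv : Tendsto P atTop (nhds P0) := by
      rw [ProbabilityMeasure.tendsto_iff_tendsto_charFun]
      intro t
      have h1 := mart_clt hadm hae hinv hcyl hg h3 t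
      have h2 := char_abs (Q := Q) (mM f p g) (rR f p g) C t _ hMm hRm (fun n => (hR n).1)
        (fun n => (hR n).2) h1
      have e0 : charFun (P0 : Measure ℝ) t = Complex.exp (-((s2 : ℝ) * t ^ 2 / 2)) := by
        change charFun (ProbabilityTheory.gaussianReal 0 σ) t = _
        rw [ProbabilityTheory.charFun_gaussianReal]
        rw [← hσ]
        congr 1
        simp
      rw [e0]
      refine h2.congr fun n => ?_
      change _ = charFun (Q.map (F n)) t
      rw [charFun_apply_real, integral_map (hFm n).aemeasurable (by fun_prop)]
    have h4 := (ProbabilityMeasure.tendsto_iff_forall_integral_tendsto.1 hconv) G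
    refine h4.congr fun n => ?_
    change ∫ y, G y ∂(Q.map (F n)) = _
    rw [integral_map (hFm n).aemeasurable G.continuous.aestronglyMeasurable]
    refine integral_congr_ae ?_
    filter_upwards [hdec n] with z hz
    rw [hz]
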